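/- Every bridgeless cubic graph G admits two perfect matchings M₁ and M₂ such that G \ (M₁ ∪ M₂) is bipartite. -/

import Mathlib

namespace DartGraph

open Finset
open scoped Classical

variable {V D : Type*} {vt : D → V} {S : Finset V} {σ : D → D}

/-- The darts leaving the vertex set `Z`. -/
noncomputable def cut [Fintype D] (vt : D → V) (σ : D → D) (Z : Finset V) : Finset D :=
  univ.filter fun d => vt d ∈ Z ∧ vt (σ d) ∉ Z

/-- The darts `a`, `b`, `c` are exactly the three darts at one vertex. -/
structure Tri (vt : D → V) (a b c : D) : Prop where
  ne_ab : a ≠ b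
  ne_ac : a ≠ c
  ne_bc : b ≠ c
  vt_b : vt b = vt a
  vt_c : vt c = vt a
  eq_of_vt : ∀ d, vt d = vt a → d = a ∨ d = b ∨ d = c

/-- On the vertex set `S`, the map `σ` matches up the darts into the edges of a cubic
multigraph. -/
structure IsCubicOn (vt : D → V) (S : Finset V) (σ : D → D) : Prop where
  mem : ∀ d, vt d ∈ S → vt (σ d) ∈ S
  invol : ∀ d, vt d ∈ S → σ (σ d) = d
  ne : ∀ d, vt d ∈ S → σ d ≠ d
  exists_dart : ∀ v ∈ S, ∃ d, vt d = v
  tri : ∀ d, vt d ∈ S → ∃ b c, Tri vt d b c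

/-- No edge is a cut of the multigraph on `S`. -/
def IsBridgelessOn [Fintype D] (vt : D → V) (S : Finset V) (σ : D → D) : Prop :=
  ∀ Z ⊆ S, #(cut vt σ Z) ≠ 1

/-- The darts satisfying `M` form a perfect matching of the multigraph on `S`. -/
structure IsPM (vt : D → V) (S : Finset V) (σ : D → D) (M : D → Prop) : Prop where
  symm : ∀ d, vt d ∈ S → M d → M (σ d)
  ex : ∀ v ∈ S, ∃ d, vt d = v ∧ M d
  uniq : ∀ d d', vt d ∈ S → vt d = vt d' → M d → M d' → d = d'

/-- The darts satisfying `H` form a subgraph of maximum degree at most two. -/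
structure IsSparse (vt : D → V) (S : Finset V) (σ : D → D) (H : D → Prop) : Prop where
  symm : ∀ d, vt d ∈ S → H d → H (σ d)
  ex : ∀ v ∈ S, ∃ d, vt d = v ∧ ¬ H d

/-- Some perfect matching contains `e` and leaves a bipartite remainder of `H`. -/
def Quells (vt : D → V) (S : Finset V) (σ : D → D) (H : D → Prop) (e : D) : Prop :=
  ∃ (M : D → Prop) (c : V → Bool), IsPM vt S σ M ∧ M e ∧
    ∀ d, vt d ∈ S → H d → ¬ M d → c (vt d) ≠ c (vt (σ d))

/-- Every sparse subgraph is quelled by a perfect matching through any prescribed dart. -/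
def IsGood (vt : D → V) (S : Finset V) (σ : D → D) : Prop :=
  ∀ H e, IsSparse vt S σ H → vt e ∈ S → Quells vt S σ H e

lemma even_card_of_involution {s : Finset D} (f : D → D) (hmem : ∀ d ∈ s, f d ∈ s)
    (hinv : ∀ d ∈ s, f (f d) = d) (hne : ∀ d ∈ s, f d ≠ d) : Even #s := by
  have h : ∑ _d ∈ s, (1 : ZMod 2) = 0 :=
    sum_involution (fun d _ => f d) (fun _ _ => by decide) (fun d hd _ => hne d hd) hmem hinv
  rw [sum_const, nsmul_eq_mul, mul_one] at h
  exact (ZMod.natCast_eq_zero_iff_even).1 h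

lemma Tri.swap {a b c : D} (t : Tri vt a b c) : Tri vt a c b :=
  ⟨t.ne_ac, t.ne_ab, t.ne_bc.symm, t.vt_c, t.vt_b,
    fun d hd => by have := t.eq_of_vt d hd; tauto⟩

lemma IsCubicOn.exists_tri_of_ne (h : IsCubicOn vt S σ) {d d' : D} (hd : vt d ∈ S)
    (hv : vt d' = vt d) (hne : d' ≠ d) : ∃ d'', Tri vt d d' d'' := by
  obtain ⟨b, c, t⟩ := h.tri d hd
  rcases t.eq_of_vt d' hv with rfl | rfl | rfl
  · exact absurd rfl hne
  · exact ⟨c, t⟩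
  · exact ⟨b, t.swap⟩

/-- The edges of the multigraph on the complement of `R` obtained by deleting `R` and joining
the loose ends according to `τ`. -/
noncomputable def rejoin (vt : D → V) (σ : D → D) (R : Finset V) (τ : D → D) (d : D) : D :=
  if vt (σ d) ∈ R then σ (τ (σ d)) else σ d

lemma rejoin_of_mem {R : Finset V} {τ : D → D} {d : D} (hd : vt (σ d) ∈ R) :
    rejoin vt σ R τ d = σ (τ (σ d)) := if_pos hd

lemma rejoin_of_notMem {R : Finset V} {τ : D → D} {d : D} (hd : vt (σ d) ∉ R) :
    rejoin vt σ R τ d = σ d := if_neg hd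

/-- A quelling matching of the rejoined multigraph extends, once it is extended over `R`. -/
lemma quells_of_rejoin (h : IsCubicOn vt S σ) {R : Finset V} {τ : D → D} {H : D → Prop}
    (hH : IsSparse vt S σ H) {e : D} (he : vt e ∈ S \ R)
    (hgood : IsGood vt (S \ R) (rejoin vt σ R τ))
    (ext : ∀ M' (c' : V → Bool), IsPM vt (S \ R) (rejoin vt σ R τ) M' → M' e →
      ∃ (N : D → Prop) (c : V → Bool),
      (∀ v ∉ R, c v = c' v) ∧ (∀ d, vt d ∈ R → vt (σ d) ∉ R → (N d ↔ M' (σ d))) ∧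
      (∀ d, vt d ∈ R → vt (σ d) ∈ R → N d → N (σ d)) ∧ (∀ v ∈ R, ∃ d, vt d = v ∧ N d) ∧
      (∀ d d', vt d ∈ R → vt d = vt d' → N d → N d' → d = d') ∧
      (∀ d, vt d ∈ R → H d → ¬ N d → c (vt d) ≠ c (vt (σ d)))) :
    Quells vt S σ H e := by
  have hH' : IsSparse vt (S \ R) (rejoin vt σ R τ) (fun d => H d ∧ vt (σ d) ∉ R) := by
    refine ⟨fun d hd hHd => ?_, fun v hv => ?_⟩
    · rw [rejoin_of_notMem hHd.2, h.invol d (mem_sdiff.1 hd).1]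
      exact ⟨hH.symm d (mem_sdiff.1 hd).1 hHd.1, (mem_sdiff.1 hd).2⟩
    · obtain ⟨d, hd, hd'⟩ := hH.ex v (mem_sdiff.1 hv).1
      exact ⟨d, hd, fun hc => hd' hc.1⟩
  obtain ⟨M', c', hM', hMe, hcol⟩ := hgood _ e hH' he
  obtain ⟨N, c, hc, hcut, hinner, hex, huniq, hNcol⟩ := ext M' c' hM' hMe
  have hsd : ∀ {d}, vt d ∈ S → vt d ∉ R → vt d ∈ S \ R := fun h1 h2 => mem_sdiff.2 ⟨h1, h2⟩
  refine ⟨fun d => if vt d ∈ R then N d else M' d, c, ⟨fun d hd hMd => ?_, fun v hv => ?_,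
    fun d d' hd hdd h1 h2 => ?_⟩, ?_, fun d hd hHd hMd => ?_⟩
  · by_cases h1 : vt d ∈ R <;> by_cases h2 : vt (σ d) ∈ R <;>
      simp only [h1, h2, if_true, if_false] at hMd ⊢
    · exact hinner d h1 h2 hMd
    · exact (hcut d h1 h2).1 hMd
    · rw [hcut _ h2 (by rwa [h.invol d hd]), h.invol d hd]
      exact hMd
    · have := hM'.symm d (hsd hd h1) hMd
      rwa [rejoin_of_notMem h2] at this
  · by_cases h1 : v ∈ R
    · obtain ⟨d, rfl, hd⟩ := hex v h1
      exact ⟨d, rfl, by simpa only [h1, if_true] using hd⟩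
    · obtain ⟨d, rfl, hd⟩ := hM'.ex v (mem_sdiff.2 ⟨hv, h1⟩)
      exact ⟨d, rfl, by simpa only [h1, if_false] using hd⟩
  · by_cases h3 : vt d ∈ R
    · have h4 := hdd ▸ h3
      simp only [h3, h4, if_true] at h1 h2
      exact huniq d d' h3 hdd h1 h2
    · have h4 := hdd ▸ h3
      simp only [h3, h4, if_false] at h1 h2
      exact hM'.uniq d d' (hsd hd h3) hdd h1 h2
  · simpa only [(mem_sdiff.1 he).2, if_false] using hMe
  · by_cases h1 : vt d ∈ R <;> simp only [h1, if_true, if_false] at hMd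
    · exact hNcol d h1 hHd hMd
    · by_cases h2 : vt (σ d) ∈ R
      · refine (hNcol (σ d) h2 (hH.symm d hd hHd) ?_).symm ∘ fun h3 => ?_
        · rw [hcut _ h2 (by rwa [h.invol d hd]), h.invol d hd]
          exact hMd
        · rw [h.invol d hd, h3]
      · have := hcol d (hsd hd h1) ⟨hHd, h2⟩ hMd
        rwa [rejoin_of_notMem h2, ← hc _ h1, ← hc _ h2] at this

variable [Fintype D]

lemma mem_cut {Z : Finset V} {d : D} : d ∈ cut vt σ Z ↔ vt d ∈ Z ∧ vt (σ d) ∉ Z := by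
  simp [cut]

lemma Tri.filter_eq {a b c : D} (t : Tri vt a b c) :
    univ.filter (fun d => vt d = vt a) = {a, b, c} := by
  ext d
  simp only [mem_filter, mem_univ, true_and, mem_insert, mem_singleton]
  exact ⟨t.eq_of_vt d, by rintro (rfl | rfl | rfl); exacts [rfl, t.vt_b, t.vt_c]⟩

lemma Tri.card_filter {a b c : D} (t : Tri vt a b c) :
    #(univ.filter fun d => vt d = vt a) = 3 := by
  rw [t.filter_eq, card_insert_of_notMem, card_pair t.ne_bc]
  simp [t.ne_ab, t.ne_ac]

lemma IsCubicOn.card_darts (h : IsCubicOn vt S σ) {Z : Finset V} (hZ : Z ⊆ S) :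
    #(univ.filter fun d => vt d ∈ Z) = 3 * #Z := by
  rw [card_eq_sum_card_fiberwise (f := vt) (t := Z) (by intro d; simp), mul_comm, ← smul_eq_mul,
    ← sum_const]
  refine sum_congr rfl fun v hv => ?_
  obtain ⟨d, rfl⟩ := h.exists_dart v (hZ hv)
  obtain ⟨b, c, t⟩ := h.tri d (hZ hv)
  rw [← t.card_filter, filter_filter]
  congr 1
  ext x
  simp only [mem_filter, mem_univ, true_and]
  exact ⟨fun hx => hx.2, fun hx => ⟨hx ▸ hv, hx⟩⟩

lemma IsCubicOn.card_cut_compl (h : IsCubicOn vt S σ) {Z : Finset V} (hZ : Z ⊆ S) :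
    #(cut vt σ (S \ Z)) = #(cut vt σ Z) := by
  have key : ∀ Z ⊆ S, ∀ d ∈ cut vt σ Z, σ d ∈ cut vt σ (S \ Z) ∧ σ (σ d) = d := by
    intro Z hZ d hd
    rw [mem_cut] at hd
    have := h.mem d (hZ hd.1)
    have h2 := h.invol d (hZ hd.1)
    simp [mem_cut, h2, hd, this]
  have hZZ : S \ (S \ Z) = Z := Finset.sdiff_sdiff_eq_self hZ
  refine card_nbij' σ σ (fun d hd => ?_) (fun d hd => (key Z hZ d hd).1) (fun d hd => ?_)
    (fun d hd => (key Z hZ d hd).2)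
  · have := (key _ sdiff_subset d hd).1
    rwa [hZZ] at this
  · exact (key _ sdiff_subset d hd).2

lemma IsCubicOn.even_internal (h : IsCubicOn vt S σ) {Z : Finset V} (hZ : Z ⊆ S) {H : D → Prop}
    (hH : ∀ d, vt d ∈ S → H d → H (σ d)) :
    Even #(univ.filter fun d => (vt d ∈ Z ∧ vt (σ d) ∈ Z) ∧ H d) := by
  refine even_card_of_involution σ ?_ ?_ ?_ <;> intro d hd <;>
    simp only [mem_filter, mem_univ, true_and] at hd ⊢
  · rw [h.invol d (hZ hd.1.1)]
    exact ⟨hd.1.symm, hH d (hZ hd.1.1) hd.2⟩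
  · exact h.invol d (hZ hd.1.1)
  · exact h.ne d (hZ hd.1.1)

lemma IsCubicOn.card_cut_mod_two (h : IsCubicOn vt S σ) {Z : Finset V} (hZ : Z ⊆ S) :
    #(cut vt σ Z) % 2 = #Z % 2 := by
  have h1 := h.card_darts hZ
  have h2 := h.even_internal hZ (H := fun _ => True) (fun _ _ _ => trivial)
  have h3 := card_filter_add_card_filter_not (s := univ.filter fun d => vt d ∈ Z)
    (fun d => vt (σ d) ∈ Z)
  simp only [filter_filter, and_true] at h2 h3
  rw [even_iff_two_dvd] at h2
  change _ + #(cut vt σ Z) = _ at h3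
  lia

lemma IsBridgelessOn.loopless (h : IsCubicOn vt S σ) (hb : IsBridgelessOn vt S σ) {d : D}
    (hd : vt d ∈ S) : vt (σ d) ≠ vt d := by
  intro hl
  obtain ⟨c, t⟩ := h.exists_tri_of_ne hd hl (h.ne d hd)
  refine hb {vt d} (by simpa using hd) (card_eq_one.2 ⟨c, ?_⟩)
  have h1 := h.invol d hd
  have h2 := h.invol c (t.vt_c ▸ hd)
  have h3 := h.ne c (t.vt_c ▸ hd)
  have hc : vt (σ c) ≠ vt d := fun hc => by
    rcases t.eq_of_vt _ hc with h4 | h4 | h4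
    · rw [h4] at h2; exact t.ne_bc h2
    · rw [h4, h1] at h2; exact t.ne_ac h2
    · exact h3 h4
  ext x
  simp only [mem_cut, mem_singleton]
  constructor
  · rintro ⟨hx, hx'⟩
    rcases t.eq_of_vt _ hx with rfl | rfl | rfl
    · exact absurd hl hx'
    · rw [h1] at hx'; exact absurd rfl hx'
    · rfl
  · rintro rfl
    exact ⟨t.vt_c, hc⟩

/-- Vertex sets with at least two vertices on either side have at least four leaving darts. -/
def HasNoSmallCut (vt : D → V) (S : Finset V) (σ : D → D) : Prop :=
  ∀ Z ⊆ S, 2 ≤ #Z → 2 ≤ #(S \ Z) → 4 ≤ #(cut vt σ Z)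

/-- `τ` pairs up the darts leaving `R`, no pair leading to a common vertex. -/
structure IsPairing (vt : D → V) (σ : D → D) (R : Finset V) (τ : D → D) : Prop where
  mem : ∀ d ∈ cut vt σ R, τ d ∈ cut vt σ R
  invol : ∀ d ∈ cut vt σ R, τ (τ d) = d
  loopless : ∀ d ∈ cut vt σ R, vt (σ (τ d)) ≠ vt (σ d)

section rejoin

variable {R : Finset V} {τ : D → D}

lemma IsCubicOn.mem_cut_of_mem (h : IsCubicOn vt S σ) {d : D} (hd : vt d ∈ S \ R)
    (hd' : vt (σ d) ∈ R) : σ d ∈ cut vt σ R := by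
  rw [mem_sdiff] at hd
  rw [mem_cut, h.invol d hd.1]
  exact ⟨hd', hd.2⟩

lemma IsCubicOn.rejoin (h : IsCubicOn vt S σ) (hR : R ⊆ S) (hτ : IsPairing vt σ R τ) :
    IsCubicOn vt (S \ R) (rejoin vt σ R τ) := by
  have hmem : ∀ d, vt d ∈ S \ R → vt (DartGraph.rejoin vt σ R τ d) ∈ S \ R := by
    intro d hd
    by_cases hd' : vt (σ d) ∈ R
    · have h1 := mem_cut.1 (hτ.mem _ (h.mem_cut_of_mem hd hd'))
      rw [rejoin_of_mem hd', mem_sdiff]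
      exact ⟨h.mem _ (hR h1.1), h1.2⟩
    · rw [rejoin_of_notMem hd', mem_sdiff]
      exact ⟨h.mem _ (mem_sdiff.1 hd).1, hd'⟩
  refine ⟨hmem, fun d hd => ?_, fun d hd => ?_, fun v hv => h.exists_dart v (mem_sdiff.1 hv).1,
    fun d hd => h.tri d (mem_sdiff.1 hd).1⟩
  · by_cases hd' : vt (σ d) ∈ R
    · have h0 := h.mem_cut_of_mem hd hd'
      have h1 := mem_cut.1 (hτ.mem _ h0)
      have h2 := h.invol _ (hR h1.1)
      rw [rejoin_of_mem hd', rejoin_of_mem (by rw [h2]; exact h1.1), h2, hτ.invol _ h0,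
        h.invol d (mem_sdiff.1 hd).1]
    · have h2 := h.invol d (mem_sdiff.1 hd).1
      rw [rejoin_of_notMem hd', rejoin_of_notMem (by rw [h2]; exact (mem_sdiff.1 hd).2), h2]
  · by_cases hd' : vt (σ d) ∈ R
    · have h0 := h.mem_cut_of_mem hd hd'
      have h1 := hτ.loopless _ h0
      rw [h.invol d (mem_sdiff.1 hd).1] at h1
      rw [rejoin_of_mem hd']
      exact fun h3 => h1 (by rw [h3])
    · rw [rejoin_of_notMem hd']
      exact h.ne d (mem_sdiff.1 hd).1

lemma IsBridgelessOn.rejoin (h : IsCubicOn vt S σ) (hb : IsBridgelessOn vt S σ)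
    (hs : HasNoSmallCut vt S σ) (hR : R ⊆ S) (hτ : IsPairing vt σ R τ) (hR2 : 2 ≤ #R)
    (hcut : #(cut vt σ R) ≤ 6) : IsBridgelessOn vt (S \ R) (rejoin vt σ R τ) := by
  have h' := h.rejoin hR hτ
  have key : ∀ Z ⊆ S \ R, #((cut vt σ Z).filter fun d => vt (σ d) ∈ R) ≤ 3 →
      #(cut vt (DartGraph.rejoin vt σ R τ) Z) ≠ 1 := by
    intro Z hZ hle h1
    have hZS : Z ⊆ S := hZ.trans sdiff_subset
    have hZR : ∀ d, vt d ∈ Z → vt d ∉ R := fun d hd => (mem_sdiff.1 (hZ hd)).2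
    have e1 := card_filter_add_card_filter_not (s := cut vt σ Z) (fun d => vt (σ d) ∈ R)
    have e2 := card_filter_add_card_filter_not
      (s := cut vt (DartGraph.rejoin vt σ R τ) Z) (fun d => vt (σ d) ∈ R)
    have e3 := card_filter_add_card_filter_not
      (s := (cut vt σ Z).filter fun d => vt (σ d) ∈ R)
      (fun d => vt (DartGraph.rejoin vt σ R τ d) ∈ Z)
    have e4 : (cut vt (DartGraph.rejoin vt σ R τ) Z).filter (fun d => vt (σ d) ∉ R) =
        (cut vt σ Z).filter (fun d => vt (σ d) ∉ R) := by
      ext d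
      simp only [mem_filter, mem_cut]
      refine and_congr_left fun hd => ?_
      rw [rejoin_of_notMem hd]
    have e5 : ((cut vt σ Z).filter fun d => vt (σ d) ∈ R).filter
        (fun d => vt (DartGraph.rejoin vt σ R τ d) ∉ Z) =
        (cut vt (DartGraph.rejoin vt σ R τ) Z).filter (fun d => vt (σ d) ∈ R) := by
      ext d
      simp only [mem_filter, mem_cut]
      have := hZR (σ d)
      tauto
    have hEmem : ∀ d, d ∈ ((cut vt σ Z).filter fun d => vt (σ d) ∈ R).filter
        (fun d => vt (DartGraph.rejoin vt σ R τ d) ∈ Z) ↔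
        vt d ∈ Z ∧ vt (σ d) ∈ R ∧ vt (DartGraph.rejoin vt σ R τ d) ∈ Z := by
      intro d
      simp only [mem_filter, mem_cut]
      have := hZR (σ d)
      tauto
    have hE : Even #(((cut vt σ Z).filter fun d => vt (σ d) ∈ R).filter
        (fun d => vt (DartGraph.rejoin vt σ R τ d) ∈ Z)) := by
      refine even_card_of_involution (DartGraph.rejoin vt σ R τ) ?_ ?_ ?_ <;> intro d hd <;>
        rw [hEmem] at hd
      · rw [hEmem, h'.invol d (hZ hd.1)]
        refine ⟨hd.2.2, ?_, hd.1⟩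
        have h3 := mem_cut.1 (hτ.mem _ (h.mem_cut_of_mem (hZ hd.1) hd.2.1))
        rw [rejoin_of_mem hd.2.1, h.invol _ (hR h3.1)]
        exact h3.1
      · exact h'.invol d (hZ hd.1)
      · exact h'.ne d (hZ hd.1)
    rw [e4] at e2
    rw [e5] at e3
    rw [even_iff_two_dvd] at hE
    have hb' := hb Z hZS
    have hcompl : 2 ≤ #(S \ Z) := hR2.trans (card_le_card fun v hv =>
      mem_sdiff.2 ⟨hR hv, fun hv' => (mem_sdiff.1 (hZ hv')).2 hv⟩)
    have hZ1 : #Z ≤ 1 := by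
      by_contra! hcon
      have := hs Z hZS hcon hcompl
      lia
    obtain ⟨d, hd⟩ : (((cut vt σ Z).filter fun d => vt (σ d) ∈ R).filter
        (fun d => vt (DartGraph.rejoin vt σ R τ d) ∈ Z)).Nonempty := by
      rw [← card_pos]
      lia
    rw [hEmem] at hd
    have h4 := card_le_one.1 hZ1 _ hd.1 _ hd.2.2
    have h5 := hτ.loopless _ (h.mem_cut_of_mem (hZ hd.1) hd.2.1)
    rw [h.invol d (hZS hd.1)] at h5
    rw [rejoin_of_mem hd.2.1] at h4
    exact h5 h4.symm
  intro Z hZ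
  by_cases hle : #((cut vt σ Z).filter fun d => vt (σ d) ∈ R) ≤ 3
  · exact key Z hZ hle
  · rw [← h'.card_cut_compl hZ]
    refine key _ sdiff_subset ?_
    have hmap : ∀ W ⊆ S \ R, #((cut vt σ W).filter fun d => vt (σ d) ∈ R) =
        #((cut vt σ R).filter fun d => vt (σ d) ∈ W) := by
      intro W hW
      have hWR : ∀ d, vt d ∈ W → vt d ∈ S ∧ vt d ∉ R := fun d hd => mem_sdiff.1 (hW hd)
      refine card_nbij' σ σ ?_ ?_ ?_ ?_ <;> intro d hd <;>
        simp only [coe_filter, Set.mem_ofPred_eq, mem_cut] at hd ⊢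
      · rw [h.invol d (hWR d hd.1.1).1]
        exact ⟨⟨hd.2, (hWR d hd.1.1).2⟩, hd.1.1⟩
      · rw [h.invol d (hR hd.1.1)]
        exact ⟨⟨hd.2, fun h0 => (hWR d h0).2 hd.1.1⟩, hd.1.1⟩
      · exact h.invol d (hWR d hd.1.1).1
      · exact h.invol d (hR hd.1.1)
    rw [hmap _ sdiff_subset]
    rw [hmap _ hZ] at hle
    have hdisj : Disjoint ((cut vt σ R).filter fun d => vt (σ d) ∈ Z)
        ((cut vt σ R).filter fun d => vt (σ d) ∈ (S \ R) \ Z) := by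
      rw [disjoint_filter]
      intro d _ hd hd'
      exact (mem_sdiff.1 hd').2 hd
    have := (card_union_of_disjoint hdisj).symm.trans_le
      (card_le_card (union_subset (filter_subset _ _) (filter_subset _ _)))
    lia

end rejoin

lemma HasNoSmallCut.simple (h : IsCubicOn vt S σ) (hb : IsBridgelessOn vt S σ)
    (hs : HasNoSmallCut vt S σ) (hS : 6 ≤ #S) {d d' : D} (hd : vt d ∈ S) (hv : vt d' = vt d)
    (hne : d' ≠ d) : vt (σ d') ≠ vt (σ d) := by
  intro hw
  obtain ⟨x, t⟩ := h.exists_tri_of_ne hd hv hne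
  have h1 := h.invol d hd
  have h2 := h.invol d' (hv ▸ hd)
  obtain ⟨y, t'⟩ := h.exists_tri_of_ne (h.mem d hd) hw (fun h3 => hne (by rw [← h2, h3, h1]))
  have hl := hb.loopless h hd
  have hcard : #({vt d, vt (σ d)} : Finset V) = 2 := card_pair hl.symm
  have hsub : {vt d, vt (σ d)} ⊆ S := by simp [insert_subset_iff, hd, h.mem d hd]
  have hcut : cut vt σ {vt d, vt (σ d)} ⊆ {x, y} := by
    intro c hc
    simp only [mem_cut, mem_insert, mem_singleton, not_or] at hc ⊢
    rcases hc.1 with h3 | h3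
    · rcases t.eq_of_vt _ h3 with rfl | rfl | rfl <;> tauto
    · rcases t'.eq_of_vt _ h3 with rfl | rfl | rfl
      · exact absurd (by rw [h1]) hc.2.1
      · exact absurd (by rw [h2, hv]) hc.2.1
      · exact Or.inr rfl
  have h4 := (card_le_card hcut).trans card_le_two
  have h5 := hs _ hsub hcard.ge (by rw [card_sdiff_of_subset hsub]; lia)
  lia

lemma HasNoSmallCut.no_triangle (h : IsCubicOn vt S σ) (hb : IsBridgelessOn vt S σ)
    (hs : HasNoSmallCut vt S σ) (hS : 6 ≤ #S) {d d' d'' : D} (hd : vt d ∈ S)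
    (hv : vt d' = vt (σ d)) (hne : d' ≠ σ d) (hv' : vt d'' = vt d) (hne' : d'' ≠ d) :
    vt (σ d') ≠ vt (σ d'') := by
  intro hw
  have hdσ := h.mem d hd
  have hd' : vt d' ∈ S := hv ▸ hdσ
  have hd'' : vt d'' ∈ S := hv' ▸ hd
  have h1 := h.invol d hd
  have h2 := h.invol d' hd'
  have h3 := h.invol d'' hd''
  have hl := hb.loopless h hd
  obtain ⟨x, tx⟩ := h.exists_tri_of_ne hd hv' hne'
  obtain ⟨y, ty⟩ := h.exists_tri_of_ne hdσ hv hne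
  obtain ⟨z, tz⟩ := h.exists_tri_of_ne (h.mem d' hd') hw.symm (fun h4 => hl (by
    rw [← hv', ← hv, ← h2, ← h3, h4]))
  have hcard : #({vt d, vt (σ d), vt (σ d')} : Finset V) ≤ 3 := card_le_three
  have hcard' : 2 ≤ #({vt d, vt (σ d), vt (σ d')} : Finset V) := by
    rw [← card_pair hl.symm]
    exact card_le_card (by simp [insert_subset_iff])
  have hsub : {vt d, vt (σ d), vt (σ d')} ⊆ S := by
    simp [insert_subset_iff, hd, hdσ, h.mem d' hd']
  have hcut : cut vt σ {vt d, vt (σ d), vt (σ d')} ⊆ {x, y, z} := by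
    intro c hc
    simp only [mem_cut, mem_insert, mem_singleton, not_or] at hc ⊢
    rcases hc.1 with h4 | h4 | h4
    · rcases tx.eq_of_vt _ h4 with rfl | rfl | rfl <;> simp_all
    · rcases ty.eq_of_vt _ h4 with rfl | rfl | rfl <;> simp_all
    · rcases tz.eq_of_vt _ h4 with rfl | rfl | rfl <;> simp_all
  have h4 := (card_le_card hcut).trans card_le_three
  have h5 := hs _ hsub hcard' (by rw [card_sdiff_of_subset hsub]; lia)
  lia

/-- The inductive hypothesis on the number of vertices. -/
def IsGoodBelow (vt : D → V) (S : Finset V) : Prop :=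
  ∀ (S' : Finset V) (σ' : D → D), #S' < #S → IsCubicOn vt S' σ' → IsBridgelessOn vt S' σ' →
    IsGood vt S' σ'

lemma quells_of_mem_near (h : IsCubicOn vt S σ) (hb : IsBridgelessOn vt S σ)
    (hs : HasNoSmallCut vt S σ) (hS : 6 ≤ #S) (hgood : IsGoodBelow vt S) {H : D → Prop}
    (hH : IsSparse vt S σ H) {e g α : D} (he : vt e ∈ S) (hg : vt g = vt e) (hge : g ≠ e)
    (hα : vt α = vt (σ g)) (hαg : α ≠ σ g) (hHα : H α) : Quells vt S σ H e := by
  have hgS : vt g ∈ S := hg ▸ he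
  have hσgS := h.mem g hgS
  have hαS : vt α ∈ S := hα ▸ hσgS
  have hσαS := h.mem α hαS
  have ig := h.invol g hgS
  have iα := h.invol α hαS
  obtain ⟨β, tx⟩ := h.exists_tri_of_ne hσgS hα hαg
  obtain ⟨γ, hγv, hγ⟩ := hH.ex _ hσαS
  have hHσα := hH.symm α hαS hHα
  obtain ⟨δ, ty⟩ := h.exists_tri_of_ne hσαS hγv (fun hc => hγ (hc ▸ hHσα))
  obtain ⟨ξ, hξv, hξ⟩ := hH.ex _ hσgS
  have hxβ : H (σ g) → ¬ H β := by
    intro h1 h2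
    rcases tx.eq_of_vt ξ hξv with rfl | rfl | rfl <;> contradiction
  have hβS : vt β ∈ S := tx.vt_c ▸ hσgS
  have hγS : vt γ ∈ S := hγv ▸ hσαS
  have hδS : vt δ ∈ S := ty.vt_c ▸ hσαS
  have iβ := h.invol β hβS
  have iγ := h.invol γ hγS
  have iδ := h.invol δ hδS
  have lg := hb.loopless h hgS
  have lα := hb.loopless h hαS
  have lβ := hb.loopless h hβS
  have lγ := hb.loopless h hγS
  have lδ := hb.loopless h hδS
  have s1 := hs.simple h hb hS hσgS hα hαg
  have s2 := hs.simple h hb hS hσgS tx.vt_c tx.ne_ac.symm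
  have s3 := hs.simple h hb hS hαS (tx.vt_c.trans hα.symm) tx.ne_bc.symm
  have s4 := hs.simple h hb hS hσαS hγv ty.ne_ab.symm
  have s5 := hs.simple h hb hS hσαS ty.vt_c ty.ne_ac.symm
  have r1 := hs.no_triangle h hb hS hαS hγv ty.ne_ab.symm hα.symm hαg.symm
  have r2 := hs.no_triangle h hb hS hαS ty.vt_c ty.ne_ac.symm (tx.vt_c.trans hα.symm) tx.ne_bc.symm
  rw [ig] at s1 s2 r1
  rw [iα] at s4 s5
  set x := vt (σ g) with hx
  set y := vt (σ α) with hy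
  have hxy : x ≠ y := by rw [← hα]; exact lα.symm
  have vβ : vt β = x := tx.vt_c
  have vδ : vt δ = y := ty.vt_c
  have hRS : {x, y} ⊆ S := by simp [insert_subset_iff, hσgS, hσαS]
  obtain ⟨ne1, ne2, ne3, -, -, ex⟩ := tx
  obtain ⟨ne4, ne5, ne6, -, -, ey⟩ := ty
  have hdart : ∀ d, vt d ∈ ({x, y} : Finset V) → d = σ g ∨ d = α ∨ d = β ∨ d = σ α ∨ d = γ ∨
      d = δ := by
    intro d hd
    simp only [mem_insert, mem_singleton] at hd
    rcases hd with hd | hd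
    · have := ex d hd; tauto
    · have := ey d hd; tauto
  have og : vt (σ (σ g)) ∉ ({x, y} : Finset V) := by
    simp only [mem_insert, mem_singleton, not_or, ig]
    exact ⟨lg.symm, s1.symm⟩
  have oα : vt (σ α) ∈ ({x, y} : Finset V) := by simp [← hy]
  have oσα : vt (σ (σ α)) ∈ ({x, y} : Finset V) := by simp [iα, hα]
  have oβ : vt (σ β) ∉ ({x, y} : Finset V) := by
    simp only [mem_insert, mem_singleton, not_or]
    exact ⟨vβ ▸ lβ, s3⟩
  have oγ : vt (σ γ) ∉ ({x, y} : Finset V) := by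
    simp only [mem_insert, mem_singleton, not_or]
    exact ⟨hα ▸ s4, hγv ▸ lγ⟩
  have oδ : vt (σ δ) ∉ ({x, y} : Finset V) := by
    simp only [mem_insert, mem_singleton, not_or]
    exact ⟨hα ▸ s5, vδ ▸ lδ⟩
  have hcut : cut vt σ {x, y} = {σ g, β, γ, δ} := by
    ext d
    rw [mem_cut]
    constructor
    · rintro ⟨h1, h2⟩
      rcases hdart d h1 with rfl | rfl | rfl | rfl | rfl | rfl <;> simp_all
    · intro h1
      have h2 : d = σ g ∨ d = β ∨ d = γ ∨ d = δ := by simpa using h1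
      rcases h2 with rfl | rfl | rfl | rfl
      · exact ⟨by simp [x], og⟩
      · exact ⟨by simp [vβ], oβ⟩
      · exact ⟨by simp [hγv], oγ⟩
      · exact ⟨by simp [vδ], oδ⟩
  have n1 : σ g ≠ γ := fun hc => hxy (by rw [hx, hc, hγv])
  have n2 : σ g ≠ δ := fun hc => hxy (by rw [hx, hc, vδ])
  have n3 : β ≠ γ := fun hc => hxy (by rw [← vβ, hc, hγv])
  have n4 : β ≠ δ := fun hc => hxy (by rw [← vβ, hc, vδ])
  have n5 : σ α ≠ β := fun hc => hxy (by rw [hy, hc, vβ])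
  have n6 : α ≠ γ := fun hc => hxy (by rw [← hα, hc, hγv])
  have n7 : α ≠ δ := fun hc => hxy (by rw [← hα, hc, vδ])
  have n8 : σ g ≠ σ α := fun hc => hxy (by rw [hx, hc])
  obtain ⟨τ, τ1, τ2, τ3, τ4⟩ : ∃ τ : D → D, τ (σ g) = γ ∧ τ γ = σ g ∧ τ β = δ ∧ τ δ = β := by
    refine ⟨fun d => if d = σ g then γ else if d = γ then σ g else if d = β then δ else β,
      ?_, ?_, ?_, ?_⟩ <;> simp [*, n1.symm, n2.symm, n4.symm, ne2.symm, ne6.symm]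
  have hτ : IsPairing vt σ {x, y} τ := by
    refine ⟨?_, ?_, ?_⟩ <;> rw [hcut] <;> intro d hd <;>
      simp only [mem_insert, mem_singleton] at hd ⊢ <;> rcases hd with rfl | rfl | rfl | rfl
    · simp [τ1]
    · simp [τ3]
    · simp [τ2]
    · simp [τ4]
    · simp [τ1, τ2]
    · simp [τ3, τ4]
    · simp [τ1, τ2]
    · simp [τ3, τ4]
    · simpa [τ1, ig] using r1
    · simpa [τ3] using r2
    · simpa [τ2, ig] using r1.symm
    · simpa [τ4] using r2.symm
  have hR2 : #({x, y} : Finset V) = 2 := card_pair hxy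
  have hcut6 : #(cut vt σ {x, y}) ≤ 6 := by
    rw [hcut]
    exact card_le_four.trans (by lia)
  have heR : vt e ∉ ({x, y} : Finset V) := by rw [← hg, ← ig]; exact og
  refine quells_of_rejoin h (R := {x, y}) (τ := τ) hH (mem_sdiff.2 ⟨he, heR⟩) (hgood _ _ ?_
    (h.rejoin hRS hτ) (hb.rejoin h hs hRS hτ hR2.ge hcut6)) ?_
  · rw [card_sdiff_of_subset hRS]
    lia
  intro M' c' hM' hMe
  have hgR : vt g ∈ S \ {x, y} := mem_sdiff.2 ⟨hgS, by rw [hg]; exact heR⟩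
  have hMg : ¬ M' g := fun hc => hge (hM'.uniq g e hgR hg hc hMe)
  have hsymm : ∀ d ∈ cut vt σ {x, y}, M' (σ d) → M' (σ (τ d)) := by
    intro d hd hMd
    have h1 := mem_cut.1 hd
    have h2 := hM'.symm (σ d) (mem_sdiff.2 ⟨h.mem _ (hRS h1.1), h1.2⟩) hMd
    rwa [rejoin_of_mem (by rw [h.invol _ (hRS h1.1)]; exact h1.1), h.invol _ (hRS h1.1)] at h2
  rw [hcut] at hsymm
  have m1 : ¬ M' (σ γ) := fun hc => hMg (by simpa [τ2, ig] using hsymm γ (by simp) hc)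
  have m2 : M' (σ β) ↔ M' (σ δ) :=
    ⟨fun hc => by simpa [τ3] using hsymm β (by simp) hc,
      fun hc => by simpa [τ4] using hsymm δ (by simp) hc⟩
  have cfree : ∀ d, vt d ∉ ({x, y} : Finset V) → vt d ≠ x ∧ vt d ≠ y := by
    intro d hd
    simpa [not_or] using hd
  have cg := cfree _ og
  have cβ := cfree _ oβ
  have cδ := cfree _ oδ
  by_cases hs : M' (σ β)
  · refine ⟨fun d => d = β ∨ d = δ,
      fun v => if v = x then !c' (vt e) else if v = y then c' (vt e) else c' v,
      ?_, ?_, ?_, ?_, ?_, ?_⟩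
    · intro v hv
      have : v ≠ x ∧ v ≠ y := by simpa [not_or] using hv
      simp [this.1, this.2]
    · intro d hd hd'
      rcases hdart d hd with rfl | rfl | rfl | rfl | rfl | rfl
      · simp [ig, ne2, n2, hMg]
      · contradiction
      · simp [hs]
      · contradiction
      · simp [n3.symm, ne6, m1]
      · simp [m2.1 hs]
    · intro d hd hd'
      rintro (rfl | rfl) <;> contradiction
    · intro v hv
      have hv' : v = x ∨ v = y := by simpa using hv
      rcases hv' with rfl | rfl
      · exact ⟨β, vβ, Or.inl rfl⟩
      · exact ⟨δ, vδ, Or.inr rfl⟩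
    · rintro d d' hd hdd (rfl | rfl) (rfl | rfl) <;> first | rfl | (exfalso; simp_all)
    · intro d hd hHd hNd
      have hxy' := hxy.symm
      rcases hdart d hd with rfl | rfl | rfl | rfl | rfl | rfl
      · rw [ig, hg] at cg ⊢
        simp [← hx, cg.1, cg.2]
      · simp [hα, ← hy, hxy']
      · simp at hNd
      · simp [iα, hα, ← hy, hxy']
      · exact absurd hHd hγ
      · simp at hNd
  · refine ⟨fun d => d = α ∨ d = σ α,
      fun v => if v = x then (if H (σ g) then !c' (vt e) else !c' (vt (σ β))) else
        if v = y then !c' (vt (σ δ)) else c' v, ?_, ?_, ?_, ?_, ?_, ?_⟩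
    · intro v hv
      have : v ≠ x ∧ v ≠ y := by simpa [not_or] using hv
      simp [this.1, this.2]
    · intro d hd hd'
      rcases hdart d hd with rfl | rfl | rfl | rfl | rfl | rfl
      · simp [ig, ne1, n8, hMg]
      · contradiction
      · simp [hs, ne3.symm, n5.symm]
      · contradiction
      · simp [n6.symm, ne4.symm, m1]
      · simp [n7.symm, ne5.symm, mt m2.2 hs]
    · intro d hd hd'
      rintro (rfl | rfl) <;> simp [iα]
    · intro v hv
      have hv' : v = x ∨ v = y := by simpa using hv
      rcases hv' with rfl | rfl
      · exact ⟨α, hα, Or.inl rfl⟩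
      · exact ⟨σ α, rfl, Or.inr rfl⟩
    · rintro d d' hd hdd (rfl | rfl) (rfl | rfl) <;> first | rfl | (exfalso; simp_all)
    · intro d hd hHd hNd
      have hxy' := hxy.symm
      rcases hdart d hd with rfl | rfl | rfl | rfl | rfl | rfl
      · rw [ig, hg] at cg ⊢
        simp [← hx, cg.1, cg.2, hHd]
      · simp at hNd
      · have : ¬ H (σ g) := fun hc => hxβ hc hHd
        simp [vβ, cβ.1, cβ.2, this]
      · simp at hNd
      · exact absurd hHd hγ
      · simp [vδ, hxy', cδ.1, cδ.2]

lemma quells_of_path (h : IsCubicOn vt S σ) (hb : IsBridgelessOn vt S σ)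
    (hs : HasNoSmallCut vt S σ) (hS : 6 ≤ #S) (hgood : IsGoodBelow vt S) {H : D → Prop}
    (hH : IsSparse vt S σ H) {e g α β ψ φ π ω ξ ζ : D} (he : vt e ∈ S) (hg : vt g = vt e)
    (hge : g ≠ e) (ta : Tri vt (σ g) α β) (tb : Tri vt (σ α) ψ φ) (tp : Tri vt (σ ψ) π ω)
    (tq : Tri vt (σ π) ξ ζ) (hHe : ∀ d, vt d = vt e → ¬ H d)
    (hHN : ∀ d d', vt d = vt e → vt d' = vt (σ d) → ¬ H d')
    (hψ : H ψ) (hφ : H φ) (hπ : H π) (hω : ¬ H ω) (hξ : H ξ) (hζ : ¬ H ζ)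
    (hβ : vt (σ β) ≠ vt (σ π)) : Quells vt S σ H e := by
  have hgS : vt g ∈ S := hg ▸ he
  have hσgS := h.mem g hgS
  have hαS : vt α ∈ S := ta.vt_b ▸ hσgS
  have hβS : vt β ∈ S := ta.vt_c ▸ hσgS
  have hσαS := h.mem α hαS
  have hψS : vt ψ ∈ S := tb.vt_b ▸ hσαS
  have hφS : vt φ ∈ S := tb.vt_c ▸ hσαS
  have hσψS := h.mem ψ hψS
  have hπS : vt π ∈ S := tp.vt_b ▸ hσψS
  have hωS : vt ω ∈ S := tp.vt_c ▸ hσψS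
  have hσπS := h.mem π hπS
  have hξS : vt ξ ∈ S := tq.vt_b ▸ hσπS
  have hζS : vt ζ ∈ S := tq.vt_c ▸ hσπS
  have ig := h.invol g hgS
  have iα := h.invol α hαS
  have iψ := h.invol ψ hψS
  have iπ := h.invol π hπS
  have hHσψ := hH.symm ψ hψS hψ
  have hHσπ := hH.symm π hπS hπ
  have hHa : ∀ d, vt d = vt (σ g) → ¬ H d := fun d hd => hHN g d hg hd
  have simple := fun {d d'} => hs.simple h hb hS (d := d) (d' := d')
  have triangle := fun {d d' d''} => hs.no_triangle h hb hS (d := d) (d' := d') (d'' := d'')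
  have loopless := fun {d} => hb.loopless h (d := d)
  set a := vt (σ g) with ha
  set b := vt (σ α) with hb'
  set p := vt (σ ψ) with hp
  set q := vt (σ π) with hq
  have vα : vt α = a := ta.vt_b
  have vβ : vt β = a := ta.vt_c
  have vψ : vt ψ = b := tb.vt_b
  have vφ : vt φ = b := tb.vt_c
  have vπ : vt π = p := tp.vt_b
  have vω : vt ω = p := tp.vt_c
  have vξ : vt ξ = q := tq.vt_b
  have vζ : vt ζ = q := tq.vt_c
  have hab : a ≠ b := fun hc => hHa ψ (vψ.trans hc.symm) hψ
  have hap : a ≠ p := fun hc => hHa π (vπ.trans hc.symm) hπ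
  have haq : a ≠ q := fun hc => hHa ξ (vξ.trans hc.symm) hξ
  have hbp : b ≠ p := vψ ▸ (loopless hψS).symm
  have hpq : p ≠ q := vπ ▸ (loopless hπS).symm
  have hbq : b ≠ q := by
    have := simple hσψS (vπ.trans hp) tp.ne_ab.symm
    rw [iψ, vψ] at this
    exact this.symm
  have hRmem : ∀ v, v ∈ ({a, b, p, q} : Finset V) ↔ v = a ∨ v = b ∨ v = p ∨ v = q := by simp
  have hRS : {a, b, p, q} ⊆ S := by
    intro v hv
    rcases (hRmem v).1 hv with rfl | rfl | rfl | rfl <;> assumption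
  obtain ⟨a1, a2, a3, -, -, ea⟩ := ta
  obtain ⟨b1, b2, b3, -, -, eb⟩ := tb
  obtain ⟨p1, p2, p3, -, -, ep⟩ := tp
  obtain ⟨q1, q2, q3, -, -, eq⟩ := tq
  have og : vt (σ (σ g)) ∉ ({a, b, p, q} : Finset V) := by
    rw [hRmem, ig, hg]
    rintro (hc | hc | hc | hc)
    · exact loopless hgS (by rw [hg, ← ha, hc])
    · exact hHe ψ (vψ.trans hc.symm) hψ
    · exact hHe π (vπ.trans hc.symm) hπ
    · exact hHe ξ (vξ.trans hc.symm) hξ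
  have oβ : vt (σ β) ∉ ({a, b, p, q} : Finset V) := by
    rw [hRmem]
    rintro (hc | hc | hc | hc)
    · exact loopless hβS (by rw [vβ, hc])
    · exact simple hαS (vβ.trans vα.symm) a3.symm hc
    · exact triangle hαS vψ b1.symm (vβ.trans vα.symm) a3.symm hc.symm
    · exact hβ hc
  have oφ : vt (σ φ) ∉ ({a, b, p, q} : Finset V) := by
    rw [hRmem]
    rintro (hc | hc | hc | hc)
    · exact hHa _ hc (hH.symm φ hφS hφ)
    · exact loopless hφS (by rw [vφ, hc])
    · exact simple hψS (vφ.trans vψ.symm) b3.symm hc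
    · exact triangle hψS vπ p1.symm (vφ.trans vψ.symm) b3.symm hc.symm
  have oω : vt (σ ω) ∉ ({a, b, p, q} : Finset V) := by
    rw [hRmem]
    rintro (hc | hc | hc | hc)
    · exact triangle hψS vω p2.symm (hb'.symm.trans vψ.symm) b1 (by rw [iα, vα, hc])
    · exact simple hσψS vω p2.symm (by rw [iψ, vψ, hc])
    · exact loopless hωS (by rw [vω, hc])
    · exact simple hπS (vω.trans vπ.symm) p3.symm hc
  have oξ : vt (σ ξ) ∉ ({a, b, p, q} : Finset V) := by
    rw [hRmem]
    rintro (hc | hc | hc | hc)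
    · exact hHa _ hc (hH.symm ξ hξS hξ)
    · exact triangle hπS vξ q1.symm (hp.symm.trans vπ.symm) p1 (by rw [iψ, vψ, hc])
    · exact simple hσπS vξ q1.symm (by rw [iπ, vπ, hc])
    · exact loopless hξS (by rw [vξ, hc])
  have oζ : vt (σ ζ) ∉ ({a, b, p, q} : Finset V) := by
    rw [hRmem]
    have iζ := h.invol ζ hζS
    rintro (hc | hc | hc | hc)
    · rcases ea _ hc with hc | hc | hc
      · rw [hc, ig] at iζ
        exact hHe ξ (vξ.trans (by rw [← vζ, ← iζ, hg])) hξ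
      · rw [hc] at iζ
        exact hbq (by rw [hb', iζ, vζ])
      · rw [hc] at iζ
        exact hβ (by rw [iζ, vζ])
    · exact triangle hπS vζ q2.symm (hp.symm.trans vπ.symm) p1 (by rw [iψ, vψ, hc])
    · exact simple hσπS vζ q2.symm (by rw [iπ, vπ, hc])
    · exact loopless hζS (by rw [vζ, hc])
  have ra : a ∈ ({a, b, p, q} : Finset V) := (hRmem _).2 (Or.inl rfl)
  have rb : b ∈ ({a, b, p, q} : Finset V) := (hRmem _).2 (Or.inr (Or.inl rfl))
  have rp : p ∈ ({a, b, p, q} : Finset V) := (hRmem _).2 (Or.inr (Or.inr (Or.inl rfl)))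
  have rq : q ∈ ({a, b, p, q} : Finset V) := (hRmem _).2 (Or.inr (Or.inr (Or.inr rfl)))
  have oσα : vt (σ (σ α)) ∈ ({a, b, p, q} : Finset V) := by rw [iα, vα]; exact ra
  have oσψ : vt (σ (σ ψ)) ∈ ({a, b, p, q} : Finset V) := by rw [iψ, vψ]; exact rb
  have oσπ : vt (σ (σ π)) ∈ ({a, b, p, q} : Finset V) := by rw [iπ, vπ]; exact rp
  have hall : ∀ P : D → Prop, P (σ g) → P α → P β → P (σ α) → P ψ → P φ → P (σ ψ) → P π → P ω →
      P (σ π) → P ξ → P ζ → ∀ d, vt d ∈ ({a, b, p, q} : Finset V) → P d := by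
    intro P k1 k2 k3 k4 k5 k6 k7 k8 k9 k10 k11 k12 d hd
    rcases (hRmem _).1 hd with hd | hd | hd | hd
    · rcases ea d hd with hd | hd | hd <;> rw [hd] <;> assumption
    · rcases eb d hd with hd | hd | hd <;> rw [hd] <;> assumption
    · rcases ep d hd with hd | hd | hd <;> rw [hd] <;> assumption
    · rcases eq d hd with hd | hd | hd <;> rw [hd] <;> assumption
  have hall_out : ∀ P : D → Prop, P (σ g) → P β → P φ → P ω → P ξ → P ζ →
      ∀ d, vt d ∈ ({a, b, p, q} : Finset V) → vt (σ d) ∉ ({a, b, p, q} : Finset V) → P d := by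
    intro P k1 k2 k3 k4 k5 k6
    exact hall _ (fun _ => k1) (fun k => absurd rb k) (fun _ => k2) (fun k => absurd oσα k)
      (fun k => absurd rp k) (fun _ => k3) (fun k => absurd oσψ k) (fun k => absurd rq k)
      (fun _ => k4) (fun k => absurd oσπ k) (fun _ => k5) (fun _ => k6)
  have hall_in : ∀ P : D → Prop, P α → P (σ α) → P ψ → P (σ ψ) → P π → P (σ π) →
      ∀ d, vt d ∈ ({a, b, p, q} : Finset V) → vt (σ d) ∈ ({a, b, p, q} : Finset V) → P d := by
    intro P k1 k2 k3 k4 k5 k6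
    exact hall _ (fun k => absurd k og) (fun _ => k1) (fun k => absurd k oβ) (fun _ => k2)
      (fun _ => k3) (fun k => absurd k oφ) (fun _ => k4) (fun _ => k5)
      (fun k => absurd k oω) (fun _ => k6) (fun k => absurd k oξ) (fun k => absurd k oζ)
  have hout : ∀ d, d ∈ ({σ g, β, φ, ω, ξ, ζ} : Finset D) ↔
      d = σ g ∨ d = β ∨ d = φ ∨ d = ω ∨ d = ξ ∨ d = ζ := by simp
  have hcut : cut vt σ {a, b, p, q} = {σ g, β, φ, ω, ξ, ζ} := by
    ext d
    rw [mem_cut, hout]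
    constructor
    · rintro ⟨h1, h2⟩
      refine hall_out (fun d => d = σ g ∨ d = β ∨ d = φ ∨ d = ω ∨ d = ξ ∨ d = ζ)
        ?_ ?_ ?_ ?_ ?_ ?_ d h1 h2 <;> simp only [true_or, or_true]
    · rintro (hd | hd | hd | hd | hd | hd) <;> rw [hd]
      · exact ⟨ra, og⟩
      · exact ⟨vβ ▸ ra, oβ⟩
      · exact ⟨vφ ▸ rb, oφ⟩
      · exact ⟨vω ▸ rp, oω⟩
      · exact ⟨vξ ▸ rq, oξ⟩
      · exact ⟨vζ ▸ rq, oζ⟩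
  have hne : ∀ {d d' : D}, vt d ≠ vt d' → d ≠ d' := fun h1 h2 => h1 (by rw [h2])
  obtain ⟨τ, τ1, τ2, τ3, τ4, τ5, τ6⟩ : ∃ τ : D → D, τ (σ g) = ζ ∧ τ ζ = σ g ∧ τ β = φ ∧ τ φ = β ∧
      τ ω = ξ ∧ τ ξ = ω := by
    have n1 : ζ ≠ σ g := hne (by rw [vζ]; exact haq.symm)
    have n2 : β ≠ ζ := hne (by rw [vζ, vβ]; exact haq)
    have n3 : φ ≠ σ g := hne (by rw [vφ]; exact hab.symm)
    have n4 : φ ≠ ζ := hne (by rw [vφ, vζ]; exact hbq)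
    have n5 : φ ≠ β := hne (by rw [vφ, vβ]; exact hab.symm)
    have n6 : ω ≠ σ g := hne (by rw [vω]; exact hap.symm)
    have n7 : ω ≠ ζ := hne (by rw [vω, vζ]; exact hpq)
    have n8 : ω ≠ β := hne (by rw [vω, vβ]; exact hap.symm)
    have n9 : ω ≠ φ := hne (by rw [vω, vφ]; exact hbp.symm)
    have m1 : ξ ≠ σ g := hne (by rw [vξ]; exact haq.symm)
    have m2 : ξ ≠ β := hne (by rw [vξ, vβ]; exact haq.symm)
    have m3 : ξ ≠ φ := hne (by rw [vξ, vφ]; exact hbq.symm)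
    have m4 : ξ ≠ ω := hne (by rw [vξ, vω]; exact hpq.symm)
    refine ⟨fun d => if d = σ g then ζ else if d = ζ then σ g else if d = β then φ else
      if d = φ then β else if d = ω then ξ else ω, ?_, ?_, ?_, ?_, ?_, ?_⟩ <;>
      simp only [n1, n2, n3, n4, n5, n6, n7, n8, n9, m1, m2, m3, m4, a2.symm, q3, if_true, if_false]
  have l1 : vt (σ ζ) ≠ vt e := by
    intro hc
    refine hHN (σ ζ) ξ hc ?_ hξ
    rw [h.invol ζ hζS, vζ, vξ]
  have l2 : vt (σ φ) ≠ vt (σ β) := triangle hαS vφ b2.symm (vβ.trans vα.symm) a3.symm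
  have l3 : vt (σ ξ) ≠ vt (σ ω) := triangle hπS vξ q1.symm (vω.trans vπ.symm) p3.symm
  have hτ : IsPairing vt σ {a, b, p, q} τ := by
    refine ⟨?_, ?_, ?_⟩ <;> rw [hcut] <;> intro d hd <;> rw [hout] at hd <;>
      rcases hd with hd | hd | hd | hd | hd | hd <;> rw [hd]
    · rw [τ1, hout]; simp only [or_true]
    · rw [τ3, hout]; simp only [true_or, or_true]
    · rw [τ4, hout]; simp only [true_or, or_true]
    · rw [τ5, hout]; simp only [true_or, or_true]
    · rw [τ6, hout]; simp only [true_or, or_true]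
    · rw [τ2, hout]; simp only [true_or]
    · rw [τ1, τ2]
    · rw [τ3, τ4]
    · rw [τ4, τ3]
    · rw [τ5, τ6]
    · rw [τ6, τ5]
    · rw [τ2, τ1]
    · rw [τ1, ig, hg]; exact l1
    · rw [τ3]; exact l2
    · rw [τ4]; exact l2.symm
    · rw [τ5]; exact l3
    · rw [τ6]; exact l3.symm
    · rw [τ2, ig, hg]; exact l1.symm
  have hR2 : 2 ≤ #({a, b, p, q} : Finset V) := by
    rw [← card_pair hab]
    exact card_le_card (by simp [insert_subset_iff])
  have hcut6 : #(cut vt σ {a, b, p, q}) ≤ 6 := by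
    rw [hcut]
    exact card_le_six
  have heR : vt e ∉ ({a, b, p, q} : Finset V) := by rw [← hg, ← ig]; exact og
  refine quells_of_rejoin h (R := {a, b, p, q}) (τ := τ) hH (mem_sdiff.2 ⟨he, heR⟩) (hgood _ _ ?_
    (h.rejoin hRS hτ) (hb.rejoin h hs hRS hτ hR2 hcut6)) ?_
  · rw [card_sdiff_of_subset hRS]
    lia
  intro M' c' hM' hMe
  have hgR : vt g ∈ S \ {a, b, p, q} := mem_sdiff.2 ⟨hgS, by rw [hg]; exact heR⟩
  have hMg : ¬ M' g := fun hc => hge (hM'.uniq g e hgR hg hc hMe)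
  have hsymm : ∀ d ∈ cut vt σ {a, b, p, q}, M' (σ d) → M' (σ (τ d)) := by
    intro d hd hMd
    have h1 := mem_cut.1 hd
    have h2 := hM'.symm (σ d) (mem_sdiff.2 ⟨h.mem _ (hRS h1.1), h1.2⟩) hMd
    rwa [rejoin_of_mem (by rw [h.invol _ (hRS h1.1)]; exact h1.1), h.invol _ (hRS h1.1)] at h2
  rw [hcut] at hsymm
  have m1 : ¬ M' (σ ζ) := fun hc => hMg (by simpa [τ2, ig] using hsymm ζ (by simp) hc)
  have m2 : M' (σ β) ↔ M' (σ φ) :=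
    ⟨fun hc => by simpa [τ3] using hsymm β (by simp) hc,
      fun hc => by simpa [τ4] using hsymm φ (by simp) hc⟩
  have m3 : M' (σ ω) ↔ M' (σ ξ) :=
    ⟨fun hc => by simpa [τ5] using hsymm ω (by simp) hc,
      fun hc => by simpa [τ6] using hsymm ξ (by simp) hc⟩
  obtain ⟨f, fa, fb, fp, fq⟩ : ∃ f : V → D, f a = (if M' (σ β) then β else α) ∧
      f b = (if M' (σ β) then φ else σ α) ∧ f p = (if M' (σ ξ) then ω else π) ∧
      f q = (if M' (σ ξ) then ξ else σ π) := by
    refine ⟨fun v => if v = a then (if M' (σ β) then β else α) else if v = b then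
      (if M' (σ β) then φ else σ α) else if v = p then (if M' (σ ξ) then ω else π) else
      (if M' (σ ξ) then ξ else σ π), ?_, ?_, ?_, ?_⟩ <;>
      simp only [hab.symm, hap.symm, haq.symm, hbp.symm, hbq.symm, hpq.symm, if_true, if_false]
  obtain ⟨c, cb, cp, cq, cc⟩ : ∃ c : V → Bool, c b = !c' (vt (σ φ)) ∧ c p = c' (vt (σ φ)) ∧
      c q = (if M' (σ ξ) then !c' (vt (σ φ)) else !c' (vt (σ ξ))) ∧
      ∀ v ∉ ({a, b, p, q} : Finset V), c v = c' v := by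
    refine ⟨fun v => if v = b then !c' (vt (σ φ)) else if v = p then c' (vt (σ φ)) else
      if v = q then
      (if M' (σ ξ) then !c' (vt (σ φ)) else !c' (vt (σ ξ))) else c' v, ?_, ?_, ?_, ?_⟩
    · simp
    · simp [hbp.symm]
    · simp [hbq.symm, hpq.symm]
    · intro v hv
      rw [hRmem] at hv
      simp only [not_or] at hv
      simp [hv.2.1, hv.2.2.1, hv.2.2.2]
  obtain ⟨N, hN⟩ : ∃ N : D → Prop, ∀ d, N d ↔ d = f (vt d) := ⟨_, fun _ => Iff.rfl⟩
  refine ⟨N, c, cc, ?_, ?_, ?_, ?_, ?_⟩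
  · refine hall_out _ ?_ ?_ ?_ ?_ ?_ ?_
    · rw [hN, ← ha, fa, ig]
      split_ifs <;> simp [a1, a2, hMg]
    · rw [hN, vβ, fa]
      split_ifs with h1 <;> simp [h1, a3.symm]
    · rw [hN, vφ, fb]
      split_ifs with h1 <;> simp [h1, ← m2, b2.symm]
    · rw [hN, vω, fp]
      split_ifs with h1 <;> simp [h1, m3, p3.symm]
    · rw [hN, vξ, fq]
      split_ifs with h1 <;> simp [h1, q1.symm]
    · rw [hN, vζ, fq]
      split_ifs with h1 <;> simp [m1, q2.symm, q3.symm]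
  · refine hall_in _ ?_ ?_ ?_ ?_ ?_ ?_
    · rw [hN, hN, vα, ← hb', fa, fb]
      split_ifs <;> simp [a3]
    · rw [hN, hN, iα, vα, ← hb', fa, fb]
      split_ifs <;> simp [b2]
    · rw [hN, hN, vψ, fb]
      split_ifs <;> simp [b1.symm, b3]
    · rw [hN, hN, ← hp, fp]
      split_ifs <;> simp [p1, p2]
    · rw [hN, hN, vπ, ← hq, fp, fq]
      split_ifs <;> simp [p3]
    · rw [hN, hN, iπ, vπ, ← hq, fp, fq]
      split_ifs <;> simp [q1]
  · intro v hv
    refine ⟨f v, ?_⟩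
    have : vt (f v) = v := by
      rcases (hRmem v).1 hv with hv | hv | hv | hv <;> rw [hv]
      · rw [fa]; split_ifs <;> assumption
      · rw [fb]; split_ifs <;> [assumption; rfl]
      · rw [fp]; split_ifs <;> assumption
      · rw [fq]; split_ifs <;> [assumption; rfl]
    exact ⟨this, (hN _).2 (by rw [this])⟩
  · intro d d' _ hdd h1 h2
    rw [hN] at h1 h2
    rw [h1, hdd, ← h2]
  · refine hall _ (fun k => absurd k (hHa _ rfl)) (fun k => absurd k (hHa _ vα))
      (fun k => absurd k (hHa _ vβ)) (fun k => absurd (hH.symm _ hσαS k) (hHa _ (by rw [iα, vα])))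
      (fun _ _ => ?_) (fun _ _ => ?_) (fun _ _ => ?_) (fun _ hNd => ?_) (fun k => absurd k hω)
      (fun _ hNd => ?_) (fun _ hNd => ?_) (fun k => absurd k hζ)
    · rw [vψ, ← hp, cb, cp]
      simp
    · rw [vφ, cb, cc _ oφ]
      simp
    · rw [iψ, vψ, ← hp, cb, cp]
      simp
    · rw [hN, vπ, fp] at hNd
      have k : M' (σ ξ) := by_contra fun k => hNd (if_neg k).symm
      rw [vπ, ← hq, cp, cq, if_pos k]
      simp
    · rw [hN, ← hq, fq] at hNd
      have k : M' (σ ξ) := by_contra fun k => hNd (if_neg k).symm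
      rw [iπ, vπ, ← hq, cp, cq, if_pos k]
      simp
    · rw [hN, vξ, fq] at hNd
      have k : ¬ M' (σ ξ) := fun k => hNd (if_pos k).symm
      rw [vξ, cq, cc _ oξ, if_neg k]
      simp

omit [Fintype D] in
lemma Quells.mono {H H' : D → Prop} {e : D} (hq : Quells vt S σ H' e) (hHH : ∀ d, H d → H' d) :
    Quells vt S σ H e := by
  obtain ⟨M, c, hM, hMe, hc⟩ := hq
  exact ⟨M, c, hM, hMe, fun d hd hHd hMd => hc d hd (hHH d hHd) hMd⟩

omit [Fintype D] in
lemma Quells.symm (h : IsCubicOn vt S σ) {H : D → Prop} {e : D} (he : vt e ∈ S)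
    (hq : Quells vt S σ H (σ e)) : Quells vt S σ H e := by
  obtain ⟨M, c, hM, hMe, hc⟩ := hq
  have := hM.symm _ (h.mem e he) hMe
  rw [h.invol e he] at this
  exact ⟨M, c, hM, this, hc⟩

/-- If an edge one step away from `e` can be added to `H`, then `H` is quelled. -/
lemma quells_of_addable (h : IsCubicOn vt S σ) (hb : IsBridgelessOn vt S σ)
    (hs : HasNoSmallCut vt S σ) (hS : 6 ≤ #S) (hgood : IsGoodBelow vt S) {H : D → Prop}
    (hH : IsSparse vt S σ H) {e g α ξ η : D} (he : vt e ∈ S) (hg : vt g = vt e)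
    (hge : g ≠ e) (hα : vt α = vt (σ g)) (hαg : α ≠ σ g) (hξ : vt ξ = vt (σ g)) (hξα : ξ ≠ α)
    (hHξ : ¬ H ξ) (hη : vt η = vt (σ α)) (hηα : η ≠ σ α) (hHη : ¬ H η) : Quells vt S σ H e := by
  have hgS : vt g ∈ S := hg ▸ he
  have hαS : vt α ∈ S := hα ▸ h.mem g hgS
  have hl := hb.loopless h hαS
  have hH' : IsSparse vt S σ fun d => H d ∨ d = α ∨ d = σ α := by
    refine ⟨fun d hd hHd => ?_, fun v hv => ?_⟩
    · rcases hHd with hHd | rfl | rfl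
      · exact Or.inl (hH.symm d hd hHd)
      · exact Or.inr (Or.inr rfl)
      · exact Or.inr (Or.inl (h.invol _ hαS))
    · by_cases h1 : v = vt α
      · refine ⟨ξ, by rw [hξ, h1, hα], ?_⟩
        rintro (hc | hc | hc)
        · exact hHξ hc
        · exact hξα hc
        · exact hl (by rw [← hc, hξ, hα])
      · by_cases h2 : v = vt (σ α)
        · refine ⟨η, by rw [hη, h2], ?_⟩
          rintro (hc | hc | hc)
          · exact hHη hc
          · exact hl (by rw [← hc, hη, hc])
          · exact hηα hc
        · obtain ⟨d, rfl, hd⟩ := hH.ex v hv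
          refine ⟨d, rfl, ?_⟩
          rintro (hc | rfl | rfl)
          · exact hd hc
          · exact h1 rfl
          · exact h2 rfl
  exact (quells_of_mem_near h hb hs hS hgood hH' he hg hge hα hαg (Or.inr (Or.inl rfl))).mono
    fun d hd => Or.inl hd

/-- If `H` is not quelled through `e`, then `H` avoids all vertices near `e`. -/
lemma not_mem_near_of_not_quells (h : IsCubicOn vt S σ) (hb : IsBridgelessOn vt S σ)
    (hs : HasNoSmallCut vt S σ) (hS : 6 ≤ #S) (hgood : IsGoodBelow vt S) {H : D → Prop}
    (hH : IsSparse vt S σ H) (hL : ∀ d, vt d ∈ S → H d → ∃ d', vt d' = vt d ∧ d' ≠ d ∧ H d')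
    {e : D} (he : vt e ∈ S) (hq : ¬ Quells vt S σ H e) :
    (∀ d, vt d = vt e → ¬ H d) ∧
      ∀ g d, vt g = vt e → g ≠ e → vt d = vt (σ g) → ¬ H d := by
  have key : ∀ g d, vt g = vt e → g ≠ e → vt d = vt (σ g) → ¬ H d := by
    intro g d hg hge hd hHd
    by_cases hdg : d = σ g
    · obtain ⟨d', h1, h2, h3⟩ := hL d (by rw [hd]; exact h.mem g (hg ▸ he)) hHd
      exact hq (quells_of_mem_near h hb hs hS hgood hH he hg hge (h1.trans hd) (hdg ▸ h2) h3)
    · exact hq (quells_of_mem_near h hb hs hS hgood hH he hg hge hd hdg hHd)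
  have key' : ∀ d, vt d = vt e → d ≠ e → ¬ H d := by
    intro d hd hde hHd
    exact key d (σ d) hd hde rfl (hH.symm d (hd ▸ he) hHd)
  refine ⟨fun d hd hHd => ?_, key⟩
  by_cases hde : d = e
  · subst hde
    obtain ⟨d', h1, h2, h3⟩ := hL d he hHd
    exact key' d' h1 h2 h3
  · exact key' d hd hde hHd

omit [Fintype D] in
lemma IsSparse.not_of_tri {H : D → Prop} (hH : IsSparse vt S σ H) {a b c : D} (ha : vt a ∈ S)
    (t : Tri vt a b c) (hHa : H a) (hHb : H b) : ¬ H c := by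
  intro hHc
  obtain ⟨d, hd, hHd⟩ := hH.ex _ ha
  rcases t.eq_of_vt d hd with rfl | rfl | rfl <;> contradiction

omit [Fintype D] in
/-- Two steps along `H` starting from the dart `ψ`. -/
lemma exists_path (h : IsCubicOn vt S σ) {H : D → Prop} (hH : IsSparse vt S σ H)
    (hL : ∀ d, vt d ∈ S → H d → ∃ d', vt d' = vt d ∧ d' ≠ d ∧ H d') {ψ : D} (hψS : vt ψ ∈ S)
    (hψ : H ψ) : ∃ π ω ξ ζ, Tri vt (σ ψ) π ω ∧ Tri vt (σ π) ξ ζ ∧ H π ∧ ¬ H ω ∧ H ξ ∧ ¬ H ζ := by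
  have step : ∀ d, vt d ∈ S → H d → ∃ b c, Tri vt (σ d) b c ∧ H b ∧ ¬ H c := by
    intro d hd hHd
    have h1 := h.mem d hd
    have h2 := hH.symm d hd hHd
    obtain ⟨b, hb1, hb2, hb3⟩ := hL _ h1 h2
    obtain ⟨c, t⟩ := h.exists_tri_of_ne h1 hb1 hb2
    exact ⟨b, c, t, hb3, hH.not_of_tri h1 t h2 hb3⟩
  obtain ⟨π, ω, tp, hπ, hω⟩ := step ψ hψS hψ
  obtain ⟨ξ, ζ, tq, hξ, hζ⟩ := step π (tp.vt_b ▸ h.mem ψ hψS) hπ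
  exact ⟨π, ω, ξ, ζ, tp, tq, hπ, hω, hξ, hζ⟩

lemma quells_of_noLeaf (h : IsCubicOn vt S σ) (hb : IsBridgelessOn vt S σ)
    (hs : HasNoSmallCut vt S σ) (hS : 6 ≤ #S) (hgood : IsGoodBelow vt S) {H : D → Prop}
    (hH : IsSparse vt S σ H) (hL : ∀ d, vt d ∈ S → H d → ∃ d', vt d' = vt d ∧ d' ≠ d ∧ H d')
    {e : D} (he : vt e ∈ S) : Quells vt S σ H e := by
  by_contra hq
  obtain ⟨hHe, hHg⟩ := not_mem_near_of_not_quells h hb hs hS hgood hH hL he hq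
  obtain ⟨hHσe, -⟩ := not_mem_near_of_not_quells h hb hs hS hgood hH hL (h.mem e he)
    (fun hc => hq (hc.symm h he))
  have hHN : ∀ d d', vt d = vt e → vt d' = vt (σ d) → ¬ H d' := by
    intro d d' hd hd'
    by_cases hde : d = e
    · exact hHσe d' (hde ▸ hd')
    · exact hHg d d' hd hde hd'
  obtain ⟨g, _, te⟩ := h.tri e he
  have hg := te.vt_b
  have hge := te.ne_ab.symm
  have hgS : vt g ∈ S := hg ▸ he
  have hσgS := h.mem g hgS
  obtain ⟨α, β, ta⟩ := h.tri _ hσgS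
  have hαS : vt α ∈ S := ta.vt_b ▸ hσgS
  have hβS : vt β ∈ S := ta.vt_c ▸ hσgS
  obtain ⟨ψ, φ, tb⟩ := h.tri _ (h.mem α hαS)
  have hHb : ∀ η, vt η = vt (σ α) → η ≠ σ α → H η := by
    intro η h1 h2
    by_contra h3
    exact hq (quells_of_addable h hb hs hS hgood hH he hg hge ta.vt_b ta.ne_ab.symm ta.vt_c
      ta.ne_bc.symm (hHN g β hg ta.vt_c) h1 h2 h3)
  have hψ := hHb ψ tb.vt_b tb.ne_ab.symm
  have hφ := hHb φ tb.vt_c tb.ne_ac.symm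
  have hψS : vt ψ ∈ S := tb.vt_b ▸ h.mem α hαS
  have hφS : vt φ ∈ S := tb.vt_c ▸ h.mem α hαS
  obtain ⟨π, ω, ξ, ζ, tp, tq, hπ, hω, hξ, hζ⟩ := exists_path h hH hL hψS hψ
  obtain ⟨π', ω', ξ', ζ', tp', tq', hπ', hω', hξ', hζ'⟩ := exists_path h hH hL hφS hφ
  have hπS : vt π ∈ S := tp.vt_b ▸ h.mem ψ hψS
  have hπS' : vt π' ∈ S := tp'.vt_b ▸ h.mem φ hφS
  have e1 : vt (σ β) = vt (σ π) := by
    by_contra hβ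
    exact hq (quells_of_path h hb hs hS hgood hH he hg hge ta tb tp tq hHe hHN hψ hφ hπ hω hξ hζ hβ)
  have e2 : vt (σ β) = vt (σ π') := by
    by_contra hβ
    exact hq (quells_of_path h hb hs hS hgood hH he hg hge ta tb.swap tp' tq' hHe hHN hφ hψ hπ' hω'
      hξ' hζ' hβ)
  have hσπ := hH.symm π hπS hπ
  have hσψ := hH.symm ψ hψS hψ
  have hσφ := hH.symm φ hφS hφ
  have iβ := h.invol β hβS
  have iπ := h.invol π hπS
  have iπ' := h.invol π' hπS'
  have n1 : σ π ≠ σ β := fun hc => hHN g β hg ta.vt_c (by rw [← iβ, ← hc, iπ]; exact hπ)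
  have n2 : σ π' ≠ σ β := fun hc => hHN g β hg ta.vt_c (by rw [← iβ, ← hc, iπ']; exact hπ')
  have n3 : σ π' ≠ σ π := fun hc => by
    have h1 : π' = π := by rw [← iπ', hc, iπ]
    refine hs.simple h hb hS hψS (tb.vt_c.trans tb.vt_b.symm) tb.ne_bc.symm ?_
    rw [← tp.vt_b, ← tp'.vt_b, h1]
  have tq0 : ∀ d, vt d = vt (σ β) → d = σ β ∨ d = σ π ∨ d = σ π' := by
    obtain ⟨x, t⟩ := h.exists_tri_of_ne (h.mem β hβS) e1.symm n1
    intro d hd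
    rcases t.eq_of_vt _ e2.symm with hc | hc | hc
    · exact absurd hc n2
    · exact absurd hc n3
    · rw [hc]
      exact t.eq_of_vt d hd
  have hcut : cut vt σ {vt (σ g), vt (σ α), vt (σ ψ), vt (σ φ), vt (σ β)} ⊆ {σ g, ω, ω'} := by
    intro d hd
    rw [mem_cut] at hd
    obtain ⟨h1, h2⟩ := hd
    simp only [mem_insert, mem_singleton, not_or] at h1 h2 ⊢
    obtain ⟨k1, k2, k3, k4, k5⟩ := h2
    rcases h1 with h1 | h1 | h1 | h1 | h1
    · rcases ta.eq_of_vt d h1 with rfl | rfl | rfl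
      · exact Or.inl rfl
      · exact absurd rfl k2
      · exact absurd rfl k5
    · rcases tb.eq_of_vt d h1 with rfl | rfl | rfl
      · exact absurd (by rw [h.invol α hαS, ta.vt_b]) k1
      · exact absurd rfl k3
      · exact absurd rfl k4
    · rcases tp.eq_of_vt d h1 with rfl | rfl | rfl
      · exact absurd (by rw [h.invol ψ hψS, tb.vt_b]) k2
      · exact absurd e1.symm k5
      · exact Or.inr (Or.inl rfl)
    · rcases tp'.eq_of_vt d h1 with rfl | rfl | rfl
      · exact absurd (by rw [h.invol φ hφS, tb.vt_c]) k2
      · exact absurd e2.symm k5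
      · exact Or.inr (Or.inr rfl)
    · rcases tq0 d h1 with rfl | rfl | rfl
      · exact absurd (by rw [iβ, ta.vt_c]) k1
      · exact absurd (by rw [iπ, tp.vt_b]) k3
      · exact absurd (by rw [iπ', tp'.vt_b]) k4
  have hav : ∀ x, (∀ d, vt d = x → ¬ H d) → x ≠ vt (σ g) →
      x ∉ ({vt (σ g), vt (σ α), vt (σ ψ), vt (σ φ), vt (σ β)} : Finset V) := by
    intro x hx hxa
    simp only [mem_insert, mem_singleton]
    rintro (hc | hc | hc | hc | hc)
    · exact hxa hc
    · exact hx ψ (tb.vt_b.trans hc.symm) hψ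
    · exact hx _ hc.symm hσψ
    · exact hx _ hc.symm hσφ
    · exact hx _ (e1.symm.trans hc.symm) hσπ
  have hsub : {vt (σ g), vt (σ α), vt (σ ψ), vt (σ φ), vt (σ β)} ⊆ S := by
    intro x hx
    simp only [mem_insert, mem_singleton] at hx
    rcases hx with rfl | rfl | rfl | rfl | rfl
    exacts [hσgS, h.mem α hαS, h.mem ψ hψS, h.mem φ hφS, h.mem β hβS]
  have hl := hb.loopless h he
  have h4 := hs _ hsub ?_ ?_
  · have := (card_le_card hcut).trans card_le_three
    lia
  · rw [← card_pair (hb.loopless h hαS)]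
    refine card_le_card ?_
    intro x hx
    simp only [mem_insert, mem_singleton] at hx ⊢
    rcases hx with rfl | rfl
    · exact Or.inr (Or.inl rfl)
    · exact Or.inl ta.vt_b
  · rw [← card_pair hl]
    refine card_le_card ?_
    intro x hx
    simp only [mem_insert, mem_singleton] at hx
    rw [mem_sdiff]
    rcases hx with rfl | rfl
    · exact ⟨h.mem e he, hav _ hHσe (hs.simple h hb hS he hg hge).symm⟩
    · refine ⟨he, hav _ hHe ?_⟩
      rw [← hg]
      exact (hb.loopless h hgS).symm

/-- `H` has no vertex of degree one. -/
def IsLeafless (vt : D → V) (S : Finset V) (H : D → Prop) : Prop :=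
  ∀ d, vt d ∈ S → H d → ∃ d', vt d' = vt d ∧ d' ≠ d ∧ H d'

/-- It suffices to quell the subgraphs without leaves. -/
lemma isGood_of_isLeafless (h : IsCubicOn vt S σ) (hb : IsBridgelessOn vt S σ)
    (hgood : ∀ H e, IsSparse vt S σ H → IsLeafless vt S H → vt e ∈ S → Quells vt S σ H e) :
    IsGood vt S σ := by
  suffices key : ∀ n H e, #(univ.filter fun d => vt d ∈ S ∧ H d) = n → IsSparse vt S σ H →
      vt e ∈ S → Quells vt S σ H e from fun H e hH he => key _ H e rfl hH he
  intro n
  induction n using Nat.strong_induction_on with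
  | _ n ih =>
    intro H e hn hH he
    by_cases hL : IsLeafless vt S H
    · exact hgood H e hH hL he
    unfold IsLeafless at hL
    push Not at hL
    obtain ⟨d, hd, hHd, hleaf⟩ := hL
    have hσd := h.mem d hd
    have id := h.invol d hd
    have hl := hb.loopless h hd
    have hH' : IsSparse vt S σ fun x => H x ∧ x ≠ d ∧ x ≠ σ d := by
      refine ⟨fun x hx hHx => ⟨hH.symm x hx hHx.1, fun hc => hHx.2.2 ?_, fun hc => hHx.2.1 ?_⟩,
        fun v hv => ?_⟩
      · rw [← hc, h.invol x hx]
      · rw [← h.invol x hx, hc, id]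
      · obtain ⟨x, hx, hHx⟩ := hH.ex v hv
        exact ⟨x, hx, fun hc => hHx hc.1⟩
    obtain ⟨M, c, hM, hMe, hc⟩ := ih _ (by
      rw [← hn]
      refine card_lt_card (ssubset_iff_of_subset ?_ |>.2 ⟨d, ?_, ?_⟩)
      · intro x
        simp only [mem_filter, mem_univ, true_and]
        exact fun hx => ⟨hx.1, hx.2.1⟩
      · simp [hd, hHd]
      · simp) _ e rfl hH' he
    refine ⟨M, fun v => if v = vt d then !c (vt (σ d)) else c v, hM, hMe, fun x hx hHx hMx => ?_⟩
    by_cases h1 : x = d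
    · subst h1
      simp [hl]
    by_cases h2 : x = σ d
    · subst h2
      simp [hl, id]
    have h3 : vt x ≠ vt d := fun hc => hleaf x hc h1 hHx
    have h4 : vt (σ x) ≠ vt d := fun hc => by
      refine hleaf (σ x) hc (fun hc => h2 ?_) (hH.symm x hx hHx)
      rw [← hc, h.invol x hx]
    simpa [h3, h4] using hc x hx ⟨hHx, h1, h2⟩ hMx

/-- A leafless sparse subgraph uses an even number of the edges of every cut. -/
lemma even_card_cut (h : IsCubicOn vt S σ) {H : D → Prop} (hH : IsSparse vt S σ H)
    (hL : IsLeafless vt S H) {X : Finset V} (hX : X ⊆ S) :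
    Even #((cut vt σ X).filter H) := by
  have hex : ∀ d, ∃ d', vt d ∈ S → H d → vt d' = vt d ∧ d' ≠ d ∧ H d' := by
    intro d
    by_cases hd : vt d ∈ S ∧ H d
    · obtain ⟨d', hd'⟩ := hL d hd.1 hd.2
      exact ⟨d', fun _ _ => hd'⟩
    · exact ⟨d, fun h1 h2 => absurd ⟨h1, h2⟩ hd⟩
  choose f hf using hex
  have h1 : Even #(univ.filter fun d => vt d ∈ X ∧ H d) := by
    refine even_card_of_involution f ?_ ?_ ?_ <;> intro d hd <;>
      simp only [mem_filter, mem_univ, true_and] at hd ⊢ <;>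
      obtain ⟨k1, k2, k3⟩ := hf d (hX hd.1) hd.2
    · rw [k1]
      exact ⟨hd.1, k3⟩
    · obtain ⟨j1, j2, j3⟩ := hf (f d) (k1 ▸ hX hd.1) k3
      obtain ⟨x, t⟩ := h.exists_tri_of_ne (hX hd.1) k1 k2
      rcases t.eq_of_vt _ (j1.trans k1) with hc | hc | hc
      · exact hc
      · exact absurd hc j2
      · exact absurd (hc ▸ j3) (hH.not_of_tri (hX hd.1) t hd.2 k3)
    · exact k2
  have h2 := h.even_internal hX hH.symm
  have h3 := card_filter_add_card_filter_not (s := univ.filter fun d => vt d ∈ X ∧ H d)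
    (fun d => vt (σ d) ∈ X)
  have e1 : (univ.filter fun d => vt d ∈ X ∧ H d).filter (fun d => vt (σ d) ∈ X) =
      univ.filter fun d => (vt d ∈ X ∧ vt (σ d) ∈ X) ∧ H d := by
    ext d
    simp only [mem_filter, mem_univ, true_and]
    tauto
  have e2 : (univ.filter fun d => vt d ∈ X ∧ H d).filter (fun d => vt (σ d) ∉ X) =
      (cut vt σ X).filter H := by
    ext d
    simp only [mem_filter, mem_univ, true_and, mem_cut]
    tauto
  rw [e1, e2] at h3
  rw [← h3] at h1
  exact (Nat.even_add.1 h1).1 h2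

/-- `f` and `g` match the darts leaving `X` with the darts at the vertex `y`. -/
structure IsAttaching (vt : D → V) (σ : D → D) (X : Finset V) (y : V) (f g : D → D) : Prop where
  vt_left : ∀ d ∈ cut vt σ X, vt (f d) = y
  left_inv : ∀ d ∈ cut vt σ X, g (f d) = d
  mem_right : ∀ d, vt d = y → g d ∈ cut vt σ X
  right_inv : ∀ d, vt d = y → f (g d) = d

lemma exists_isAttaching (h : IsCubicOn vt S σ) {X : Finset V} (hc : #(cut vt σ X) = 3) {y : V}
    (hy : y ∈ S) : ∃ f g, IsAttaching vt σ X y f g := by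
  obtain ⟨d, rfl⟩ := h.exists_dart y hy
  obtain ⟨b, c, t⟩ := h.tri d hy
  let e : cut vt σ X ≃ univ.filter fun x => vt x = vt d :=
    equivOfCardEq (hc.trans t.card_filter.symm)
  have hmem : ∀ x, vt x = vt d → x ∈ univ.filter fun x => vt x = vt d := fun x hx => by simpa
  refine ⟨fun x => if hx : x ∈ cut vt σ X then e ⟨x, hx⟩ else x,
    fun x => if hx : vt x = vt d then e.symm ⟨x, hmem x hx⟩ else x,
    fun x hx => ?_, fun x hx => ?_, fun x hx => ?_, fun x hx => ?_⟩
  · have := (e ⟨x, hx⟩).2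
    rw [mem_filter] at this
    simpa only [hx, dif_pos] using this.2
  · have := (e ⟨x, hx⟩).2
    rw [mem_filter] at this
    simp only [hx, dif_pos, this.2, Subtype.coe_eta, Equiv.symm_apply_apply]
  · simp only [hx, dif_pos]
    exact (e.symm ⟨x, hmem x hx⟩).2
  · simp [hx]

/-- The edges of the multigraph obtained by contracting everything outside `X` to `y`. -/
noncomputable def contract (vt : D → V) (σ : D → D) (X : Finset V) (y : V) (f g : D → D)
    (d : D) : D :=
  if vt d = y then g d else if vt (σ d) ∈ X then σ d else f d

section contract

variable {X : Finset V} {y : V} {f g : D → D}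

omit [Fintype D] in
lemma contract_of_eq {d : D} (hd : vt d = y) : contract vt σ X y f g d = g d := if_pos hd

omit [Fintype D] in
lemma contract_of_mem (hy : y ∉ X) {d : D} (hd : vt d ∈ X) (hd' : vt (σ d) ∈ X) :
    contract vt σ X y f g d = σ d := by
  rw [contract, if_neg (fun hc => hy (by rwa [← hc])), if_pos hd']

lemma contract_of_mem_cut (hy : y ∉ X) {d : D} (hd : d ∈ cut vt σ X) :
    contract vt σ X y f g d = f d := by
  rw [mem_cut] at hd
  rw [contract, if_neg (fun hc => hy (by rw [← hc]; exact hd.1)), if_neg hd.2]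

lemma IsCubicOn.contract (h : IsCubicOn vt S σ) (hX : X ⊆ S) (hyS : y ∈ S) (hy : y ∉ X)
    (ha : IsAttaching vt σ X y f g) :
    IsCubicOn vt (insert y X) (DartGraph.contract vt σ X y f g) := by
  have hsub : insert y X ⊆ S := insert_subset hyS hX
  have key : ∀ d, vt d ∈ insert y X →
      vt (DartGraph.contract vt σ X y f g d) ∈ insert y X ∧
      DartGraph.contract vt σ X y f g (DartGraph.contract vt σ X y f g d) = d ∧
      DartGraph.contract vt σ X y f g d ≠ d := by
    intro d hd
    rcases mem_insert.1 hd with hd | hd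
    · have h1 := ha.mem_right d hd
      rw [contract_of_eq hd, contract_of_mem_cut hy h1, ha.right_inv d hd]
      have h2 := (mem_cut.1 h1).1
      exact ⟨mem_insert_of_mem h2, rfl, fun hc => hy (by rwa [hc, hd] at h2)⟩
    · by_cases hd' : vt (σ d) ∈ X
      · have hi := h.invol d (hX hd)
        rw [contract_of_mem hy hd hd', contract_of_mem hy hd' (by rwa [hi]), hi]
        exact ⟨mem_insert_of_mem hd', rfl, h.ne d (hX hd)⟩
      · have h1 : d ∈ cut vt σ X := mem_cut.2 ⟨hd, hd'⟩
        have h2 := ha.vt_left d h1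
        rw [contract_of_mem_cut hy h1, contract_of_eq h2, ha.left_inv d h1]
        exact ⟨mem_insert.2 (Or.inl h2), rfl, fun hc => hy (by rwa [← h2, hc])⟩
  exact ⟨fun d hd => (key d hd).1, fun d hd => (key d hd).2.1, fun d hd => (key d hd).2.2,
    fun v hv => h.exists_dart v (hsub hv), fun d hd => h.tri d (hsub hd)⟩

lemma IsBridgelessOn.contract (h : IsCubicOn vt S σ) (hb : IsBridgelessOn vt S σ) (hX : X ⊆ S)
    (hyS : y ∈ S) (hy : y ∉ X) (ha : IsAttaching vt σ X y f g) :
    IsBridgelessOn vt (insert y X) (DartGraph.contract vt σ X y f g) := by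
  have key : ∀ Z ⊆ X, #(cut vt (DartGraph.contract vt σ X y f g) Z) ≠ 1 := by
    intro Z hZ
    have : cut vt (DartGraph.contract vt σ X y f g) Z = cut vt σ Z := by
      ext d
      rw [mem_cut, mem_cut]
      refine and_congr_right fun hd => ?_
      by_cases hd' : vt (σ d) ∈ X
      · rw [contract_of_mem hy (hZ hd) hd']
      · have h1 : d ∈ cut vt σ X := mem_cut.2 ⟨hZ hd, hd'⟩
        rw [contract_of_mem_cut hy h1, ha.vt_left d h1]
        exact ⟨fun _ hc => hd' (hZ hc), fun _ hc => hy (hZ hc)⟩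
    rw [this]
    exact hb Z (hZ.trans hX)
  intro Z hZ
  by_cases hyZ : y ∈ Z
  · rw [← (h.contract hX hyS hy ha).card_cut_compl hZ]
    refine key _ fun v hv => ?_
    rw [mem_sdiff, mem_insert] at hv
    rcases hv.1 with rfl | h1
    · exact absurd hyZ hv.2
    · exact h1
  · refine key _ fun v hv => ?_
    rcases mem_insert.1 (hZ hv) with rfl | h1
    · exact absurd hv hyZ
    · exact h1

/-- The part of a quelling matching inside `X`, where `X` is one side of a 3-edge-cut. -/
lemma exists_quelling_side (h : IsCubicOn vt S σ) (hb : IsBridgelessOn vt S σ)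
    (hgood : IsGoodBelow vt S) {H : D → Prop} (hH : IsSparse vt S σ H) (hL : IsLeafless vt S H)
    (hX : X ⊆ S) (hX2 : 2 ≤ #(S \ X)) (hcut : #(cut vt σ X) = 3) {e : D} (he : vt e ∈ X) :
    ∃ (M : D → Prop) (c : V → Bool), ∃ d₀ ∈ cut vt σ X, M e ∧ (∀ d ∈ cut vt σ X, M d ↔ d = d₀) ∧
      (∀ d, vt d ∈ X → vt (σ d) ∈ X → M d → M (σ d)) ∧ (∀ v ∈ X, ∃ d, vt d = v ∧ M d) ∧
      (∀ d d', vt d ∈ X → vt d = vt d' → M d → M d' → d = d') ∧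
      (∀ d, vt d ∈ X → vt (σ d) ∈ X → H d → ¬ M d → c (vt d) ≠ c (vt (σ d))) ∧
      (∀ d ∈ cut vt σ X, H d → d ≠ d₀ → c (vt d) = true) := by
  obtain ⟨y, hy⟩ : (S \ X).Nonempty := card_pos.1 (by lia)
  obtain ⟨hyS, hy⟩ := mem_sdiff.1 hy
  obtain ⟨f, g, ha⟩ := exists_isAttaching h hcut hyS
  have hXy : ∀ {d}, vt d ∈ X → vt d ≠ y := fun hd hc => hy (by rwa [← hc])
  have hmem : ∀ {d}, vt d ∈ X → vt d ∈ insert y X := fun hd => mem_insert_of_mem hd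
  have hlt : #(insert y X) < #S := by
    rw [card_insert_of_notMem hy]
    rw [card_sdiff_of_subset hX] at hX2
    lia
  obtain ⟨d₁, hd₁, hHd₁⟩ : ∃ d ∈ cut vt σ X, ¬ H d := by
    by_contra! hc
    have := even_card_cut h hH hL hX
    rw [filter_true_of_mem hc, hcut] at this
    exact absurd this (by decide)
  have hH' : IsSparse vt (insert y X) (contract vt σ X y f g)
      (fun d => if vt d = y then H (g d) else H d) := by
    refine ⟨fun d hd hHd => ?_, fun v hv => ?_⟩
    · rcases mem_insert.1 hd with hd | hd
      · have h1 := hXy (mem_cut.1 (ha.mem_right d hd)).1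
        rw [if_pos hd] at hHd
        rwa [contract_of_eq hd, if_neg h1]
      · rw [if_neg (hXy hd)] at hHd
        by_cases hd' : vt (σ d) ∈ X
        · rw [contract_of_mem hy hd hd', if_neg (hXy hd')]
          exact hH.symm d (hX hd) hHd
        · have h1 : d ∈ cut vt σ X := mem_cut.2 ⟨hd, hd'⟩
          rwa [contract_of_mem_cut hy h1, if_pos (ha.vt_left d h1), ha.left_inv d h1]
    · rcases mem_insert.1 hv with rfl | hv
      · refine ⟨f d₁, ha.vt_left d₁ hd₁, ?_⟩
        rwa [if_pos (ha.vt_left d₁ hd₁), ha.left_inv d₁ hd₁]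
      · obtain ⟨d, rfl, hd⟩ := hH.ex v (hX hv)
        exact ⟨d, rfl, by rwa [if_neg (hXy hv)]⟩
  obtain ⟨M, c, hM, hMe, hc⟩ := hgood _ _ hlt (h.contract hX hyS hy ha)
    (hb.contract h hX hyS hy ha) _ e hH' (hmem he)
  obtain ⟨t₀, ht₀, hMt₀⟩ := hM.ex y (mem_insert_self _ _)
  have hg₀ := ha.mem_right t₀ ht₀
  refine ⟨M, fun v => c v ^^ c y, g t₀, hg₀, hMe, fun d hd => ⟨fun hMd => ?_, ?_⟩,
    fun d hd hd' hMd => ?_, fun v hv => hM.ex v (mem_insert_of_mem hv),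
    fun d d' hd => hM.uniq d d' (hmem hd), fun d hd hd' hHd hMd => ?_, fun d hd hHd hne => ?_⟩
  · have h1 := hM.symm d (hmem (mem_cut.1 hd).1) hMd
    rw [contract_of_mem_cut hy hd] at h1
    have h2 := ha.vt_left d hd
    rw [← hM.uniq (f d) t₀ (by rw [h2]; exact mem_insert_self _ _) (h2.trans ht₀.symm) h1 hMt₀,
      ha.left_inv d hd]
  · rintro rfl
    have h1 := hM.symm t₀ (by rw [ht₀]; exact mem_insert_self _ _) hMt₀
    rwa [contract_of_eq ht₀] at h1
  · have h1 := hM.symm d (hmem hd) hMd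
    rwa [contract_of_mem hy hd hd'] at h1
  · have h1 := hc d (hmem hd) (by beta_reduce; rwa [if_neg (hXy hd)]) hMd
    rw [contract_of_mem hy hd hd'] at h1
    simpa using h1
  · have hd' := (mem_cut.1 hd).1
    have hMd : ¬ M d := fun hMd => hne (by
      have h1 := hM.symm d (hmem hd') hMd
      rw [contract_of_mem_cut hy hd] at h1
      have h2 := ha.vt_left d hd
      rw [← hM.uniq (f d) t₀ (by rw [h2]; exact mem_insert_self _ _) (h2.trans ht₀.symm) h1 hMt₀,
        ha.left_inv d hd])
    have h1 := hc d (hmem hd') (by beta_reduce; rwa [if_neg (hXy hd')]) hMd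
    rw [contract_of_mem_cut hy hd, ha.vt_left d hd] at h1
    simpa using h1

end contract

lemma quells_of_cut (h : IsCubicOn vt S σ) (hb : IsBridgelessOn vt S σ)
    (hgood : IsGoodBelow vt S) {H : D → Prop} (hH : IsSparse vt S σ H) (hL : IsLeafless vt S H)
    {X : Finset V} (hX : X ⊆ S) (hX1 : 2 ≤ #X) (hX2 : 2 ≤ #(S \ X)) (hcut : #(cut vt σ X) = 3)
    {e : D} (he : vt e ∈ X) : Quells vt S σ H e := by
  obtain ⟨M, c, d₀, hd₀, hMe, hM₀, hMsymm, hMex, hMuniq, hMc, hMcut⟩ :=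
    exists_quelling_side h hb hgood hH hL hX hX2 hcut he
  have hmem : ∀ {d}, vt d ∈ S → vt d ∉ X → vt d ∈ S \ X := fun h1 h2 => mem_sdiff.2 ⟨h1, h2⟩
  have hcut' : ∀ d, d ∈ cut vt σ X → σ d ∈ cut vt σ (S \ X) := by
    intro d hd
    obtain ⟨h1, h2⟩ := mem_cut.1 hd
    rw [mem_cut, h.invol d (hX h1)]
    exact ⟨hmem (h.mem d (hX h1)) h2, fun hc => (mem_sdiff.1 hc).2 h1⟩
  obtain ⟨N, c', d₁, hd₁, hNe, hN₁, hNsymm, hNex, hNuniq, hNc, hNcut⟩ :=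
    exists_quelling_side h hb hgood hH hL (X := S \ X) sdiff_subset
      (by rwa [Finset.sdiff_sdiff_eq_self hX])
      (by rw [h.card_cut_compl hX, hcut]) (mem_cut.1 (hcut' d₀ hd₀)).1
  have e1 : d₁ = σ d₀ := ((hN₁ _ (hcut' d₀ hd₀)).1 hNe).symm
  have hN₀ : ∀ d ∈ cut vt σ X, N (σ d) ↔ d = d₀ := by
    intro d hd
    rw [hN₁ _ (hcut' d hd), e1]
    refine ⟨fun hc => ?_, fun hc => by rw [hc]⟩
    rw [← h.invol d (hX (mem_cut.1 hd).1), hc, h.invol d₀ (hX (mem_cut.1 hd₀).1)]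
  refine ⟨fun d => if vt d ∈ X then M d else N d, fun v => if v ∈ X then c v else !c' v,
    ⟨fun d hd hMd => ?_, fun v hv => ?_, fun d d' hd hdd h1 h2 => ?_⟩, ?_, ?_⟩
  · by_cases h1 : vt d ∈ X <;> by_cases h2 : vt (σ d) ∈ X <;>
      simp only [h1, h2, if_true, if_false] at hMd ⊢
    · exact hMsymm d h1 h2 hMd
    · have h3 : d ∈ cut vt σ X := mem_cut.2 ⟨h1, h2⟩
      exact (hN₀ d h3).2 ((hM₀ d h3).1 hMd)
    · have h3 : σ d ∈ cut vt σ X := mem_cut.2 ⟨h2, by rwa [h.invol d hd]⟩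
      exact (hM₀ _ h3).2 ((hN₀ _ h3).1 (by rwa [h.invol d hd]))
    · exact hNsymm d (hmem hd h1) (hmem (h.mem d hd) h2) hMd
  · by_cases h1 : v ∈ X
    · obtain ⟨d, rfl, hd⟩ := hMex v h1
      exact ⟨d, rfl, by rwa [if_pos h1]⟩
    · obtain ⟨d, rfl, hd⟩ := hNex v (mem_sdiff.2 ⟨hv, h1⟩)
      exact ⟨d, rfl, by rwa [if_neg h1]⟩
  · by_cases h3 : vt d ∈ X
    · have h4 := hdd ▸ h3
      rw [if_pos h3] at h1
      rw [if_pos h4] at h2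
      exact hMuniq d d' h3 hdd h1 h2
    · have h4 := hdd ▸ h3
      rw [if_neg h3] at h1
      rw [if_neg h4] at h2
      exact hNuniq d d' (hmem hd h3) hdd h1 h2
  · beta_reduce; rwa [if_pos he]
  · have key : ∀ d ∈ cut vt σ X, H d → d ≠ d₀ → c (vt d) ≠ !c' (vt (σ d)) := by
      intro d hd hHd hne
      have hdS := hX (mem_cut.1 hd).1
      rw [hMcut d hd hHd hne, hNcut (σ d) (hcut' d hd) (hH.symm d hdS hHd)]
      · simp
      · rw [e1]
        intro hc
        exact hne (by rw [← h.invol d hdS, hc, h.invol d₀ (hX (mem_cut.1 hd₀).1)])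
    intro d hd hHd hMd
    by_cases h1 : vt d ∈ X <;> by_cases h2 : vt (σ d) ∈ X <;>
      simp only [h1, h2, if_true, if_false] at hMd ⊢
    · exact hMc d h1 h2 hHd hMd
    · have h3 : d ∈ cut vt σ X := mem_cut.2 ⟨h1, h2⟩
      exact key d h3 hHd fun hc => hMd ((hM₀ d h3).2 hc)
    · have h3 : σ d ∈ cut vt σ X := mem_cut.2 ⟨h2, by rwa [h.invol d hd]⟩
      have h4 := key _ h3 (hH.symm d hd hHd) fun hc => hMd (by
        have := (hN₀ _ h3).2 hc
        rwa [h.invol d hd] at this)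
      rw [h.invol d hd] at h4
      exact h4.symm
    · simpa using hNc d (hmem hd h1) (hmem (h.mem d hd) h2) hHd hMd

/-- A nontrivial edge cut of size at most three leads to one of size exactly three. -/
lemma exists_card_cut_eq_three (h : IsCubicOn vt S σ) (hb : IsBridgelessOn vt S σ) (hS : 6 ≤ #S)
    (hs : ¬ HasNoSmallCut vt S σ) :
    ∃ X ⊆ S, 2 ≤ #X ∧ 2 ≤ #(S \ X) ∧ #(cut vt σ X) = 3 := by
  have key : ∀ Z ⊆ S, 3 ≤ #Z → 2 ≤ #(S \ Z) → #(cut vt σ Z) = 0 ∨ #(cut vt σ Z) = 2 →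
      ∃ X ⊆ S, 2 ≤ #X ∧ 2 ≤ #(S \ X) ∧ #(cut vt σ X) = 3 := by
    intro Z hZ hZ3 hZ2 hcut
    obtain ⟨d, hd, hle⟩ : ∃ d, vt d ∈ Z ∧ #(cut vt σ (Z.erase (vt d))) ≤ 3 := by
      have sub : ∀ d, vt d ∈ Z → ∀ x ∈ cut vt σ (Z.erase (vt d)),
          (x ∈ cut vt σ Z ∧ vt x ≠ vt d) ∨ (vt (σ x) = vt d ∧ σ (σ x) = x ∧ vt x ∈ Z) := by
        intro d hd x hx
        simp only [mem_cut, mem_erase, not_and] at hx ⊢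
        by_cases h1 : vt (σ x) = vt d
        · exact Or.inr ⟨h1, h.invol x (hZ hx.1.2), hx.1.2⟩
        · exact Or.inl ⟨⟨hx.1.2, hx.2 h1⟩, hx.1.1⟩
      rcases hcut with hcut | hcut
      · obtain ⟨v, hv⟩ : Z.Nonempty := card_pos.1 (by lia)
        obtain ⟨d, rfl⟩ := h.exists_dart v (hZ hv)
        obtain ⟨b, c, t⟩ := h.tri d (hZ hv)
        refine ⟨d, hv, (card_le_card (t := ({d, b, c} : Finset D).image σ) ?_).trans
          (card_image_le.trans card_le_three)⟩
        intro x hx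
        rw [card_eq_zero] at hcut
        rcases sub d hv x hx with h1 | h1
        · rw [hcut] at h1
          simp at h1
        · rw [mem_image, ← t.filter_eq]
          exact ⟨σ x, by simp [h1.1], h1.2.1⟩
      · obtain ⟨d, hd⟩ : (cut vt σ Z).Nonempty := card_pos.1 (by lia)
        have hdZ := (mem_cut.1 hd).1
        obtain ⟨b, c, t⟩ := h.tri d (hZ hdZ)
        refine ⟨d, hdZ, (card_le_card (t := (cut vt σ Z).erase d ∪
          ({b, c} : Finset D).image σ) ?_).trans ((card_union_le _ _).trans ?_)⟩
        · intro x hx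
          rw [mem_union, mem_erase, mem_image]
          rcases sub d hdZ x hx with h1 | h1
          · exact Or.inl ⟨fun hc => h1.2 (by rw [hc]), h1.1⟩
          · refine Or.inr ⟨σ x, ?_, h1.2.1⟩
            rw [mem_insert, mem_singleton]
            rcases t.eq_of_vt _ h1.1 with hc | hc
            · exact absurd (by rw [← hc, h1.2.1]; exact h1.2.2) (mem_cut.1 hd).2
            · exact hc
        · rw [card_erase_of_mem hd, hcut]
          have : #(({b, c} : Finset D).image σ) ≤ 2 := card_image_le.trans card_le_two
          lia
    have hX : Z.erase (vt d) ⊆ S := (erase_subset _ _).trans hZ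
    have h1 := card_erase_of_mem hd
    have h2 := h.card_cut_mod_two hZ
    have h3 := h.card_cut_mod_two hX
    have h4 := hb _ hX
    refine ⟨Z.erase (vt d), hX, by lia, ?_, by lia⟩
    exact hZ2.trans (card_le_card (sdiff_subset_sdiff subset_rfl (erase_subset _ _)))
  unfold HasNoSmallCut at hs
  push Not at hs
  obtain ⟨Z, hZ, h1, h2, h3⟩ := hs
  have h4 := hb Z hZ
  have h5 := card_sdiff_add_card_eq_card hZ
  by_cases h6 : #(cut vt σ Z) = 3
  · exact ⟨Z, hZ, h1, h2, h6⟩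
  by_cases h7 : 3 ≤ #Z
  · exact key Z hZ h7 h2 (by lia)
  · refine key (S \ Z) sdiff_subset (by lia) ?_ ?_
    · rwa [Finset.sdiff_sdiff_eq_self hZ]
    · rw [h.card_cut_compl hZ]
      lia

lemma IsPM.card_darts {M : D → Prop} (hM : IsPM vt S σ M) {X : Finset V} (hX : X ⊆ S) :
    #(univ.filter fun d => vt d ∈ X ∧ M d) = #X := by
  refine card_nbij vt (fun d hd => ?_) (fun d hd d' hd' hdd => ?_) (fun v hv => ?_)
  · exact (mem_filter.1 hd).2.1
  · have h1 := (mem_filter.1 hd).2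
    have h2 := (mem_filter.1 hd').2
    exact hM.uniq d d' (hX h1.1) hdd h1.2 h2.2
  · obtain ⟨d, rfl, hd⟩ := hM.ex v (hX hv)
    exact ⟨d, mem_filter.2 ⟨mem_univ _, hv, hd⟩, rfl⟩

/-- A perfect matching quells everything if all other edges leave some half of the vertices. -/
lemma quells_of_balanced (h : IsCubicOn vt S σ) {H M : D → Prop} {e : D} (hM : IsPM vt S σ M)
    (hMe : M e) {X : Finset V} (hX : X ⊆ S) (hcard : #(S \ X) = #X)
    (hcross : ∀ d, vt d ∈ X → ¬ M d → vt (σ d) ∉ X) : Quells vt S σ H e := by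
  have count : ∀ Z ⊆ S, #(univ.filter fun d => vt d ∈ Z ∧ ¬ M d) = 2 * #Z := by
    intro Z hZ
    have h1 := h.card_darts hZ
    have h2 := hM.card_darts hZ
    have h3 := card_filter_add_card_filter_not (s := univ.filter fun d => vt d ∈ Z) M
    simp only [filter_filter] at h3
    lia
  have himg : (univ.filter fun d => vt d ∈ X ∧ ¬ M d).image σ =
      univ.filter fun d => vt d ∈ S \ X ∧ ¬ M d := by
    refine eq_of_subset_of_card_le (fun x hx => ?_) ?_
    · obtain ⟨d, hd, rfl⟩ := mem_image.1 hx
      simp only [mem_filter, mem_univ, true_and] at hd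
      simp only [mem_filter, mem_univ, true_and, mem_sdiff]
      refine ⟨⟨h.mem d (hX hd.1), hcross d hd.1 hd.2⟩, fun hc => hd.2 ?_⟩
      rw [← h.invol d (hX hd.1)]
      exact hM.symm _ (h.mem d (hX hd.1)) hc
    · rw [card_image_of_injOn, count _ sdiff_subset, count _ hX, hcard]
      intro d hd d' hd' hdd
      rw [← h.invol d (hX (mem_filter.1 hd).2.1), hdd, h.invol d' (hX (mem_filter.1 hd').2.1)]
  refine ⟨M, fun v => decide (v ∈ X), hM, hMe, fun d hd _ hMd => ?_⟩
  by_cases hdX : vt d ∈ X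
  · simp [hdX, hcross d hdX hMd]
  · have h1 : d ∈ univ.filter fun d => vt d ∈ S \ X ∧ ¬ M d := by simp [hd, hdX, hMd]
    rw [← himg, mem_image] at h1
    obtain ⟨d', h2, rfl⟩ := h1
    have h3 := (mem_filter.1 h2).2.1
    simp [hdX, h.invol d' (hX h3), h3]

lemma isGood_of_card_eq_two (h : IsCubicOn vt S σ) (hb : IsBridgelessOn vt S σ) (hS : #S = 2) :
    IsGood vt S σ := by
  intro H e _ he
  have hσe := h.mem e he
  have hl := hb.loopless h he
  have hSe : {vt e, vt (σ e)} = S := by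
    refine eq_of_subset_of_card_le (by simp [insert_subset_iff, he, hσe]) ?_
    rw [card_pair hl.symm, hS]
  have hmem : ∀ x ∈ S, x = vt e ∨ x = vt (σ e) := fun x hx => by simpa [← hSe] using hx
  refine quells_of_balanced h (M := fun d => d = e ∨ d = σ e) (X := {vt e})
    ⟨?_, ?_, ?_⟩ (Or.inl rfl) (by simpa using he) ?_ ?_
  · rintro d hd (rfl | rfl)
    · exact Or.inr rfl
    · exact Or.inl (h.invol e he)
  · intro v hv
    rcases hmem v hv with rfl | rfl
    · exact ⟨e, rfl, Or.inl rfl⟩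
    · exact ⟨σ e, rfl, Or.inr rfl⟩
  · rintro d d' - hdd (rfl | rfl) (rfl | rfl)
    · rfl
    · exact absurd hdd.symm hl
    · exact absurd hdd hl
    · rfl
  · rw [card_sdiff_of_subset (by simpa using he), hS, card_singleton]
  · intro d hd _
    rw [mem_singleton] at hd ⊢
    rw [← hd]
    exact hb.loopless h (hd ▸ he)

lemma isGood_of_card_eq_four (h : IsCubicOn vt S σ) (hb : IsBridgelessOn vt S σ) (hS : #S = 4) :
    IsGood vt S σ := by
  intro H e _ he
  have hσe := h.mem e he
  have hl := hb.loopless h he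
  have hsub : {vt e, vt (σ e)} ⊆ S := by simp [insert_subset_iff, he, hσe]
  have hT : #(S \ {vt e, vt (σ e)}) = 2 := by
    rw [card_sdiff_of_subset hsub, card_pair hl.symm, hS]
  obtain ⟨f, hf, hσf⟩ : ∃ f, vt f ∈ S \ {vt e, vt (σ e)} ∧ vt (σ f) ∈ S \ {vt e, vt (σ e)} := by
    by_contra! hc
    have h1 : univ.filter (fun d => vt d ∈ S \ {vt e, vt (σ e)}) ⊆
        cut vt σ (S \ {vt e, vt (σ e)}) := by
      intro d hd
      rw [mem_filter] at hd
      exact mem_cut.2 ⟨hd.2, hc d hd.2⟩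
    have h2 := card_le_card h1
    rw [h.card_darts sdiff_subset, hT, h.card_cut_compl hsub] at h2
    have h3 : cut vt σ {vt e, vt (σ e)} ⊆
        ((univ.filter fun d => vt d ∈ ({vt e, vt (σ e)} : Finset V)).erase e).erase (σ e) := by
      intro d hd
      rw [mem_cut] at hd
      rw [mem_erase, mem_erase, mem_filter]
      refine ⟨?_, ?_, mem_univ _, hd.1⟩
      · rintro rfl
        exact hd.2 (by simp [h.invol e he])
      · rintro rfl
        exact hd.2 (by simp)
    have h4 := card_le_card h3
    rw [card_erase_of_mem (by simp [h.ne e he]), card_erase_of_mem (by simp),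
      h.card_darts hsub, card_pair hl.symm] at h4
    lia
  obtain ⟨hfS, hfe⟩ := mem_sdiff.1 hf
  obtain ⟨hσfS, hσfe⟩ := mem_sdiff.1 hσf
  simp only [mem_insert, mem_singleton, not_or] at hfe hσfe
  obtain ⟨k1, k2⟩ := hfe
  obtain ⟨k3, k4⟩ := hσfe
  have k5 := hb.loopless h hfS
  have k1' := Ne.symm k1
  have k2' := Ne.symm k2
  have k3' := Ne.symm k3
  have k4' := Ne.symm k4
  have k5' := k5.symm
  have hl' := hl.symm
  have hTf : {vt f, vt (σ f)} = S \ {vt e, vt (σ e)} := by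
    refine eq_of_subset_of_card_le ?_ (by rw [hT, card_pair k5'])
    intro x hx
    rw [mem_insert, mem_singleton] at hx
    rcases hx with rfl | rfl <;> assumption
  have hmem : ∀ x ∈ S, x = vt e ∨ x = vt (σ e) ∨ x = vt f ∨ x = vt (σ f) := by
    intro x hx
    by_cases h1 : x ∈ ({vt e, vt (σ e)} : Finset V)
    · rw [mem_insert, mem_singleton] at h1
      tauto
    · have h2 := mem_sdiff.2 ⟨hx, h1⟩
      rw [← hTf, mem_insert, mem_singleton] at h2
      tauto
  obtain ⟨g₁, g₂, t⟩ := h.tri e he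
  obtain ⟨w, hw⟩ : (S \ {vt e, vt (σ g₁), vt (σ g₂)}).Nonempty := by
    rw [← card_pos]
    have h1 : #({vt e, vt (σ g₁), vt (σ g₂)} : Finset V) ≤ 3 := card_le_three
    have h2 := le_card_sdiff {vt e, vt (σ g₁), vt (σ g₂)} S
    lia
  simp only [mem_sdiff, mem_insert, mem_singleton, not_or] at hw
  obtain ⟨hwS, w1, w2, w3⟩ := hw
  have hXS : {vt e, w} ⊆ S := by simp [insert_subset_iff, he, hwS]
  refine quells_of_balanced h (M := fun d => d = e ∨ d = σ e ∨ d = f ∨ d = σ f) (X := {vt e, w})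
    ⟨?_, ?_, ?_⟩ (Or.inl rfl) hXS ?_ ?_
  · rintro d hd (rfl | rfl | rfl | rfl)
    · exact Or.inr (Or.inl rfl)
    · exact Or.inl (h.invol e he)
    · exact Or.inr (Or.inr (Or.inr rfl))
    · exact Or.inr (Or.inr (Or.inl (h.invol f hfS)))
  · intro v hv
    rcases hmem v hv with rfl | rfl | rfl | rfl
    · exact ⟨e, rfl, Or.inl rfl⟩
    · exact ⟨σ e, rfl, Or.inr (Or.inl rfl)⟩
    · exact ⟨f, rfl, Or.inr (Or.inr (Or.inl rfl))⟩
    · exact ⟨σ f, rfl, Or.inr (Or.inr (Or.inr rfl))⟩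
  · intro d d' _ hdd h1 h2
    rcases h1 with h1 | h1 | h1 | h1 <;> rcases h2 with h2 | h2 | h2 | h2 <;>
      rw [h1, h2] at hdd <;> rw [h1, h2] <;> contradiction
  · rw [card_sdiff_of_subset hXS, hS, card_pair (Ne.symm w1)]
  · have hu : ∀ d, vt d = vt e → d ≠ e → vt (σ d) ≠ w ∧ vt (σ d) ≠ vt e := by
      intro d hd hde
      refine ⟨?_, hd ▸ hb.loopless h (hd ▸ he)⟩
      rcases t.eq_of_vt d hd with rfl | rfl | rfl
      · exact absurd rfl hde
      · exact Ne.symm w2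
      · exact Ne.symm w3
    intro d hd hMd
    simp only [mem_insert, mem_singleton, not_or] at hd hMd ⊢
    rcases hd with hd | hd
    · exact (hu d hd hMd.1).symm
    · have hdS : vt d ∈ S := hd ▸ hwS
      refine ⟨fun hc => (hu _ hc fun hc' => hMd.2.1 ?_).1 ?_, hd ▸ hb.loopless h hdS⟩
      · rw [← hc', h.invol d hdS]
      · rw [h.invol d hdS, hd]

/-- In a bridgeless cubic multigraph, every sparse subgraph is quelled by a perfect matching
through any prescribed edge. -/
theorem isGood (h : IsCubicOn vt S σ) (hb : IsBridgelessOn vt S σ) : IsGood vt S σ := by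
  suffices key : ∀ n S σ, #S = n → IsCubicOn vt S σ → IsBridgelessOn vt S σ → IsGood vt S σ from
    key _ S σ rfl h hb
  clear h hb
  intro n
  induction n using Nat.strong_induction_on with
  | _ n ih =>
    intro S σ hn h hb
    have hbelow : IsGoodBelow vt S := fun S' σ' hlt => ih _ (hn ▸ hlt) S' σ' rfl
    have hcutS : #(cut vt σ S) = 0 := by
      rw [card_eq_zero, eq_empty_iff_forall_notMem]
      intro d hd
      rw [mem_cut] at hd
      exact hd.2 (h.mem d hd.1)
    have hpar := h.card_cut_mod_two (subset_refl S)
    by_cases hS : 6 ≤ #S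
    · refine isGood_of_isLeafless h hb fun H e hH hL he => ?_
      by_cases hs : HasNoSmallCut vt S σ
      · exact quells_of_noLeaf h hb hs hS hbelow hH hL he
      obtain ⟨X, hX, h1, h2, h3⟩ := exists_card_cut_eq_three h hb hS hs
      by_cases heX : vt e ∈ X
      · exact quells_of_cut h hb hbelow hH hL hX h1 h2 h3 heX
      · refine quells_of_cut h hb hbelow hH hL (X := S \ X) sdiff_subset h2 ?_ ?_
          (mem_sdiff.2 ⟨he, heX⟩)
        · rwa [Finset.sdiff_sdiff_eq_self hX]
        · rwa [h.card_cut_compl hX]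
    · by_cases h2 : #S = 2
      · exact isGood_of_card_eq_two h hb h2
      by_cases h4 : #S = 4
      · exact isGood_of_card_eq_four h hb h4
      have h0 : S = ∅ := by
        rw [← card_eq_zero]
        lia
      intro H e _ he
      rw [h0] at he
      simp at he

variable {W : Type*} [Fintype W]

theorem isCubicOn_dart (G : SimpleGraph W) (hG : ∀ v : W, (G.neighborSet v).ncard = 3) :
    IsCubicOn (fun d : G.Dart => d.fst) univ SimpleGraph.Dart.symm where
  mem _ _ := mem_univ _
  invol d _ := d.symm_symm
  ne d _ := d.symm_ne
  exists_dart v _ := by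
    obtain ⟨w, hw⟩ := Set.nonempty_of_ncard_ne_zero (s := G.neighborSet v) (by rw [hG]; decide)
    exact ⟨⟨(v, w), hw⟩, rfl⟩
  tri d _ := by
    obtain ⟨⟨v, w⟩, hd⟩ := d
    replace hd : G.Adj v w := hd
    have hw : w ∈ G.neighborSet v := hd
    have h2 : (G.neighborSet v \ {w}).ncard = 2 := by
      rw [Set.ncard_sdiff_singleton_of_mem hw, hG]
    obtain ⟨x, y, hxy, h⟩ := Set.ncard_eq_two.1 h2
    have hx : x ∈ G.neighborSet v \ {w} := by simp [h]
    have hy : y ∈ G.neighborSet v \ {w} := by simp [h]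
    have hwx : w ≠ x := fun hc => hx.2 hc.symm
    have hwy : w ≠ y := fun hc => hy.2 hc.symm
    refine ⟨⟨(v, x), hx.1⟩, ⟨(v, y), hy.1⟩, ?_, ?_, ?_, rfl, rfl, ?_⟩
    · simp [SimpleGraph.Dart.ext_iff, hwx]
    · simp [SimpleGraph.Dart.ext_iff, hwy]
    · simp [SimpleGraph.Dart.ext_iff, hxy]
    · rintro ⟨⟨u, z⟩, hz⟩ rfl
      have hz' : z = w ∨ z ∈ G.neighborSet u \ {w} := by
        by_cases hzw : z = w
        · exact Or.inl hzw
        · exact Or.inr ⟨hz, hzw⟩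
      rw [h] at hz'
      simpa [SimpleGraph.Dart.ext_iff] using hz'

theorem isBridgelessOn_dart (G : SimpleGraph W) (hG : ∀ e ∈ G.edgeSet, ¬ G.IsBridge e) :
    IsBridgelessOn (fun d : G.Dart => d.fst) univ SimpleGraph.Dart.symm := by
  intro Z _ hZ
  obtain ⟨d, hd⟩ := card_eq_one.1 hZ
  have hdm : d ∈ cut (fun d : G.Dart => d.fst) SimpleGraph.Dart.symm Z := by simp [hd]
  rw [mem_cut] at hdm
  have huniq : ∀ u w, G.Adj u w → u ∈ Z → w ∉ Z → s(u, w) = d.edge := by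
    intro u w huw hu hw
    have h1 : (⟨(u, w), huw⟩ : G.Dart) ∈ cut (fun d : G.Dart => d.fst) SimpleGraph.Dart.symm Z :=
      mem_cut.2 ⟨hu, hw⟩
    rw [hd, mem_singleton] at h1
    rw [← h1]
    rfl
  refine hG d.edge d.edge_mem ?_
  obtain ⟨⟨a, b⟩, hab⟩ := d
  refine SimpleGraph.isBridge_iff.2 fun hr => hdm.2 ?_
  obtain ⟨p⟩ := hr
  have hwalk : ∀ x y (_ : (G.deleteEdges {s(a, b)}).Walk x y), x ∈ Z → y ∈ Z := by
    intro x y q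
    induction q with
    | nil => exact id
    | cons hadj _ ih =>
      rw [SimpleGraph.deleteEdges_adj] at hadj
      intro hx
      refine ih ?_
      by_contra hy
      exact hadj.2 (huniq _ _ hadj.1 hx hy)
  exact hwalk _ _ p hdm.1

/-- The spanning subgraph formed by the edges satisfying a predicate on darts. -/
def subgraphOfDarts {G : SimpleGraph W} (M : G.Dart → Prop) (hM : ∀ d, M d → M d.symm) :
    G.Subgraph where
  verts := Set.univ
  Adj u v := ∃ h : G.Adj u v, M ⟨(u, v), h⟩
  adj_sub h := h.1
  edge_vert _ := Set.mem_univ _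
  symm := ⟨fun _ _ h => ⟨h.1.symm, hM _ h.2⟩⟩

theorem IsPM.isPerfectMatching {G : SimpleGraph W} {M : G.Dart → Prop}
    (h : IsPM (fun d : G.Dart => d.fst) univ SimpleGraph.Dart.symm M)
    (hM : ∀ d, M d → M d.symm) : (subgraphOfDarts M hM).IsPerfectMatching := by
  refine ⟨fun v _ => ?_, fun _ => Set.mem_univ _⟩
  obtain ⟨d, rfl, hd⟩ := h.ex v (mem_univ _)
  refine ⟨d.snd, ⟨d.adj, hd⟩, ?_⟩
  rintro w ⟨hw, hMw⟩
  exact congrArg (fun d : G.Dart => d.snd) (h.uniq ⟨(d.fst, w), hw⟩ d (mem_univ _) rfl hMw hd)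

/-- Every cubic graph none of whose edges is a bridge, connected or not, has two perfect matchings
whose deletion leaves a bipartite graph. -/
theorem exists_isPerfectMatching_pair (G : SimpleGraph W)
    (hG : ∀ v : W, (G.neighborSet v).ncard = 3) (hb : ∀ e ∈ G.edgeSet, ¬ G.IsBridge e) :
    ∃ M₁ M₂ : G.Subgraph, M₁.IsPerfectMatching ∧ M₂.IsPerfectMatching ∧
      (G.deleteEdges (M₁.edgeSet ∪ M₂.edgeSet)).Colorable 2 := by
  have h := isCubicOn_dart G hG
  have hgood := isGood h (isBridgelessOn_dart G hb)
  rcases isEmpty_or_nonempty W with hW | ⟨⟨v⟩⟩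
  · refine ⟨⊤, ⊤, ⟨fun v => hW.elim v, fun v => hW.elim v⟩,
      ⟨fun v => hW.elim v, fun v => hW.elim v⟩, ?_⟩
    exact SimpleGraph.Colorable.of_isEmpty _
  obtain ⟨e, -⟩ := h.exists_dart v (mem_univ v)
  obtain ⟨M, -, hM, -, -⟩ := hgood (fun _ => False) e
    ⟨fun _ _ hd => hd, fun v hv => (h.exists_dart v hv).imp fun _ hd => ⟨hd, id⟩⟩ (mem_univ _)
  have hMs : ∀ d, M d → M d.symm := fun d => hM.symm d (mem_univ _)
  obtain ⟨N, c, hN, -, hc⟩ := hgood (fun d => ¬ M d) e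
    ⟨fun d _ hd hd' => hd (by simpa using hMs _ hd'),
      fun v hv => (hM.ex v hv).imp fun _ hd => ⟨hd.1, not_not.2 hd.2⟩⟩ (mem_univ _)
  have hNs : ∀ d, N d → N d.symm := fun d => hN.symm d (mem_univ _)
  refine ⟨subgraphOfDarts M hMs, subgraphOfDarts N hNs, hM.isPerfectMatching hMs,
    hN.isPerfectMatching hNs, ?_⟩
  have hcol : ∀ {u v}, (G.deleteEdges ((subgraphOfDarts M hMs).edgeSet ∪
      (subgraphOfDarts N hNs).edgeSet)).Adj u v → c u ≠ c v := by
    intro u v huv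
    rw [SimpleGraph.deleteEdges_adj, Set.mem_union, SimpleGraph.Subgraph.mem_edgeSet,
      SimpleGraph.Subgraph.mem_edgeSet, not_or] at huv
    exact hc ⟨(u, v), huv.1⟩ (mem_univ _) (fun hd => huv.2.1 ⟨huv.1, hd⟩)
      fun hd => huv.2.2 ⟨huv.1, hd⟩
  simpa using (SimpleGraph.Coloring.mk c hcol).colorable

end DartGraph

/-- **The S₄-Conjecture (Mazzuoccolo).** Every bridgeless cubic graph admits two perfect
matchings whose deletion leaves a bipartite graph. -/
theorem exists_S4_pair {V : Type*} [Fintype V] (G : SimpleGraph V)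
    (hcubic : ∀ v : V, (G.neighborSet v).ncard = 3)
    (hbridgeless : ∀ e : Sym2 V, ¬ G.IsBridge e) :
    ∃ M₁ M₂ : G.Subgraph, M₁.IsPerfectMatching ∧ M₂.IsPerfectMatching ∧
      (G.deleteEdges (M₁.edgeSet ∪ M₂.edgeSet)).Colorable 2 := by
  exact DartGraph.exists_isPerfectMatching_pair G hcubic fun e _ => hbridgeless e
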